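/- arXiv:math/0305062 — 7 statements merged into one kernel-verified Lean document; each statement's English description precedes it below -/
import Mathlib

section
/- Let P ⊆ h* be any two-dimensional linear subspace and set R₀ = R ∩ P. Then for every α ∈ R₀ the commutator relation [κ_α, Σ_{β ∈ R₀} κ_β] = 0 holds in the universal enveloping algebra U(g). (Equivalently, for any system of positive roots R⁺ ⊆ R and any α ∈ R₀ ∩ R⁺, [κ_α, Σ_{β ∈ R₀ ∩ R⁺} κ_β] = 0.) This is the system of commutation relations that, by Kohno's criterion, is equivalent to the flatness of the Casimir connection ∇κ = d − h Σ_{α∈R⁺} (dα/α)·κ_α. -/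
open LieAlgebra UniversalEnvelopingAlgebra

/-- `x` is a root vector for the functional `α` on the Cartan subalgebra `H`. -/
def IsRootVector {L : Type} [LieRing L] [LieAlgebra ℂ L] (H : LieSubalgebra ℂ L)
    (α : Module.Dual ℂ H) (x : L) : Prop :=
  ∀ t : H, ⁅(t : L), x⁆ = α t • x

lemma UniversalEnvelopingAlgebra.ι_lie {L : Type} [LieRing L] [LieAlgebra ℂ L] (x y : L) :
    ι ℂ ⁅x, y⁆ = ι ℂ x * ι ℂ y - ι ℂ y * ι ℂ x :=
  letI := LieRing.ofAssociativeRing (A := UniversalEnvelopingAlgebra ℂ L)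
  (ι ℂ).map_lie'

lemma UniversalEnvelopingAlgebra.ι_smul {L : Type} [LieRing L] [LieAlgebra ℂ L] (r : ℂ) (x : L) :
    ι ℂ (r • x) = r • ι ℂ x :=
  letI := LieRing.ofAssociativeRing (A := UniversalEnvelopingAlgebra ℂ L)
  (ι ℂ).toLinearMap.map_smul r x

lemma UniversalEnvelopingAlgebra.ι_zero {L : Type} [LieRing L] [LieAlgebra ℂ L] :
    ι ℂ (0 : L) = 0 :=
  letI := LieRing.ofAssociativeRing (A := UniversalEnvelopingAlgebra ℂ L)
  (ι ℂ).toLinearMap.map_zero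

lemma UniversalEnvelopingAlgebra.ι_neg {L : Type} [LieRing L] [LieAlgebra ℂ L] (x : L) :
    ι ℂ (-x) = -ι ℂ x :=
  letI := LieRing.ofAssociativeRing (A := UniversalEnvelopingAlgebra ℂ L)
  (ι ℂ).toLinearMap.map_neg x

namespace IsRootVector

variable {L : Type} [LieRing L] [LieAlgebra ℂ L] {H : LieSubalgebra ℂ L}
  {α β : Module.Dual ℂ H} {x y : L}

lemma smul (r : ℂ) (hx : IsRootVector H α x) : IsRootVector H α (r • x) := fun t ↦ by
  rw [lie_smul, hx t, smul_comm]

lemma lie (hx : IsRootVector H α x) (hy : IsRootVector H β y) :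
    IsRootVector H (α + β) ⁅x, y⁆ := fun t ↦ by
  rw [leibniz_lie, hx t, hy t, smul_lie, lie_smul, LinearMap.add_apply, add_smul]

/-- Over a semisimple Lie algebra, any root vector is a multiple of a given nonzero one. -/
lemma exists_smul_eq [FiniteDimensional ℂ L] [LieAlgebra.IsSemisimple ℂ L]
    [H.IsCartanSubalgebra] (hα : α ≠ 0) (hx : IsRootVector H α x) (hx0 : x ≠ 0)
    (hy : IsRootVector H α y) : ∃ r : ℂ, r • x = y := by
  have mem {z : L} (hz : IsRootVector H α z) : z ∈ rootSpace H α :=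
    LieModule.weightSpace_le_genWeightSpace L α ((LieModule.mem_weightSpace _ z).mpr hz)
  have hne : rootSpace H α ≠ ⊥ := fun h ↦ hx0 <| by simpa [h] using mem hx
  have h1 := LieAlgebra.IsKilling.finrank_rootSpace_eq_one (K := ℂ) (H := H)
    (⟨α, hne⟩ : LieModule.Weight ℂ H L) (fun h ↦ hα (by ext t; exact congrFun h t))
  obtain ⟨r, hr⟩ := (finrank_eq_one_iff_of_nonzero' (⟨x, mem hx⟩ : rootSpace H α)
    (by simpa using hx0)).mp h1 ⟨y, mem hy⟩
  exact ⟨r, congrArg Subtype.val hr⟩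

end IsRootVector

/-- Families of root vectors `x β`, `y β` of weights `β`, `-β`, for `β` in a symmetric set `S` of
roots which is closed under sums, spanning the root spaces and dual under `B`. -/
structure IsDualRootFamily {L : Type} [LieRing L] [LieAlgebra ℂ L] (H : LieSubalgebra ℂ L)
    (B : LinearMap.BilinForm ℂ L) (S : Finset (Module.Dual ℂ H))
    (x y : Module.Dual ℂ H → L) : Prop where
  invariant : ∀ u v w, B ⁅u, v⁆ w = B u ⁅v, w⁆
  symm : ∀ u v, B u v = B v u
  zero_notMem : 0 ∉ S
  neg_mem : ∀ β ∈ S, -β ∈ S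
  eq_zero : ∀ α ∈ S, ∀ β ∈ S, α + β ≠ 0 → α + β ∉ S → ∀ z, IsRootVector H (α + β) z → z = 0
  left : ∀ β ∈ S, IsRootVector H β (x β)
  right : ∀ β ∈ S, IsRootVector H (-β) (y β)
  pairing : ∀ β ∈ S, B (x β) (y β) = 1
  eq_smul_left : ∀ β ∈ S, ∀ z, IsRootVector H β z → z = B z (y β) • x β
  eq_smul_right : ∀ β ∈ S, ∀ z, IsRootVector H (-β) z → z = B z (x β) • y β

namespace IsDualRootFamily

variable {L : Type} [LieRing L] [LieAlgebra ℂ L] {H : LieSubalgebra ℂ L}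
  {B : LinearMap.BilinForm ℂ L} {S : Finset (Module.Dual ℂ H)} {x y : Module.Dual ℂ H → L}

/-- Replacing `β` by `-β` exchanges the two families, up to inverse scalars. -/
lemma exists_neg (h : IsDualRootFamily H B S x y) {β : Module.Dual ℂ H} (hβ : β ∈ S) :
    ∃ r s : ℂ, r * s = 1 ∧ x (-β) = r • y β ∧ y (-β) = s • x β := by
  have hx := h.eq_smul_right β hβ _ (h.left _ (h.neg_mem _ hβ))
  have hy := h.eq_smul_left β hβ (y (-β)) (by simpa using h.right _ (h.neg_mem _ hβ))
  refine ⟨_, _, ?_, hx, hy⟩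
  have hp := h.pairing _ (h.neg_mem _ hβ)
  generalize B (x (-β)) (x β) = r at *
  generalize B (y (-β)) (y β) = s at *
  rw [hx, hy, map_smul, map_smul, LinearMap.smul_apply, h.symm, h.pairing _ hβ] at hp
  simpa [mul_comm] using hp

lemma left_neg_mul_right_neg (h : IsDualRootFamily H B S x y) {β : Module.Dual ℂ H} (hβ : β ∈ S) :
    ι ℂ (x (-β)) * ι ℂ (y (-β)) = ι ℂ (y β) * ι ℂ (x β) := by
  obtain ⟨r, s, hrs, hx, hy⟩ := h.exists_neg hβ
  rw [hx, hy, ι_smul, ι_smul, smul_mul_smul_comm, hrs, one_smul]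

/-- The contributions of `β` and `α + β` to a commutator with a vector of weight `α` cancel. -/
lemma lie_mul_add_mul_lie (h : IsDualRootFamily H B S x y) {α β : Module.Dual ℂ H} {z : L}
    (hz : IsRootVector H α z) (hβ : β ∈ S) (hαβ : α + β ∈ S) :
    ι ℂ ⁅z, x β⁆ * ι ℂ (y β) + ι ℂ (x (α + β)) * ι ℂ ⁅z, y (α + β)⁆ = 0 := by
  have h1 := h.eq_smul_left _ hαβ _ (hz.lie (h.left _ hβ))
  have h2 := h.eq_smul_right β hβ ⁅z, y (α + β)⁆ (by
    have := hz.lie (h.right _ hαβ)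
    rwa [show α + -(α + β) = -β by abel] at this)
  have h3 : B ⁅z, y (α + β)⁆ (x β) = - B ⁅z, x β⁆ (y (α + β)) := by
    rw [← lie_skew, map_neg, LinearMap.neg_apply, h.invariant, h.symm]
  rw [h1, h2, h3, ι_smul, ι_smul, smul_mul_assoc, mul_smul_comm, neg_smul, add_neg_cancel]

/-- The commutator of a root vector with the truncated Casimir sum. -/
lemma commutator_sum (h : IsDualRootFamily H B S x y) {α : Module.Dual ℂ H} {z : L}
    (hα : α ∈ S) (hz : IsRootVector H α z) :
    ι ℂ z * (∑ β ∈ S, ι ℂ (x β) * ι ℂ (y β)) - (∑ β ∈ S, ι ℂ (x β) * ι ℂ (y β)) * ι ℂ z =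
      ι ℂ ⁅z, x (-α)⁆ * ι ℂ (y (-α)) + ι ℂ (x α) * ι ℂ ⁅z, y α⁆ := by
  classical
  have hleft : ∑ β ∈ S, ι ℂ ⁅z, x β⁆ * ι ℂ (y β) = ι ℂ ⁅z, x (-α)⁆ * ι ℂ (y (-α)) +
      ∑ β ∈ S with α + β ∈ S, ι ℂ ⁅z, x β⁆ * ι ℂ (y β) := by
    rw [← Finset.add_sum_erase _ _ (h.neg_mem _ hα)]
    congr 1
    refine (Finset.sum_subset (fun β hβ ↦ ?_) fun β hβ hβ' ↦ ?_).symm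
    · rw [Finset.mem_filter] at hβ
      refine Finset.mem_erase.mpr ⟨?_, hβ.1⟩
      rintro rfl
      exact h.zero_notMem (by simpa using hβ.2)
    · obtain ⟨hne, hβS⟩ := Finset.mem_erase.mp hβ
      rw [h.eq_zero α hα β hβS (fun h0 ↦ hne (neg_eq_of_add_eq_zero_right h0).symm)
        (fun hS ↦ hβ' (Finset.mem_filter.mpr ⟨hβS, hS⟩)) _ (hz.lie (h.left _ hβS)),
        ι_zero, zero_mul]
  have hright : ∑ β ∈ S, ι ℂ (x β) * ι ℂ ⁅z, y β⁆ = ι ℂ (x α) * ι ℂ ⁅z, y α⁆ +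
      ∑ β ∈ S with β - α ∈ S, ι ℂ (x β) * ι ℂ ⁅z, y β⁆ := by
    rw [← Finset.add_sum_erase _ _ hα]
    congr 1
    refine (Finset.sum_subset (fun β hβ ↦ ?_) fun β hβ hβ' ↦ ?_).symm
    · rw [Finset.mem_filter] at hβ
      refine Finset.mem_erase.mpr ⟨?_, hβ.1⟩
      rintro rfl
      exact h.zero_notMem (by simpa using hβ.2)
    · obtain ⟨hne, hβS⟩ := Finset.mem_erase.mp hβ
      rw [h.eq_zero α hα (-β) (h.neg_mem _ hβS)
        (fun h0 ↦ hne (eq_of_sub_eq_zero (by rwa [sub_eq_add_neg])).symm)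
        (fun hS ↦ hβ' (Finset.mem_filter.mpr ⟨hβS, ?_⟩)) _ (hz.lie (h.right _ hβS)),
        ι_zero, mul_zero]
      simpa [sub_eq_add_neg, add_comm] using h.neg_mem _ hS
  have hcancel : ∑ β ∈ S with α + β ∈ S, ι ℂ ⁅z, x β⁆ * ι ℂ (y β) =
      -∑ β ∈ S with β - α ∈ S, ι ℂ (x β) * ι ℂ ⁅z, y β⁆ := by
    rw [← Finset.sum_neg_distrib]
    refine Finset.sum_nbij' (α + ·) (· - α) ?_ ?_ ?_ ?_ ?_
    · intro β hβ
      simpa [and_comm] using hβ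
    · intro β hβ
      simpa [and_comm] using hβ
    · intro β _
      abel
    · intro β _
      abel
    · intro β hβ
      rw [Finset.mem_filter] at hβ
      exact eq_neg_of_add_eq_zero_left (h.lie_mul_add_mul_lie hz hβ.1 hβ.2)
  have hsum : ι ℂ z * (∑ β ∈ S, ι ℂ (x β) * ι ℂ (y β)) -
      (∑ β ∈ S, ι ℂ (x β) * ι ℂ (y β)) * ι ℂ z =
      ∑ β ∈ S, ι ℂ ⁅z, x β⁆ * ι ℂ (y β) + ∑ β ∈ S, ι ℂ (x β) * ι ℂ ⁅z, y β⁆ := by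
    rw [Finset.mul_sum, Finset.sum_mul, ← Finset.sum_sub_distrib, ← Finset.sum_add_distrib]
    refine Finset.sum_congr rfl fun β _ ↦ ?_
    rw [ι_lie, ι_lie]
    noncomm_ring
  rw [hsum, hleft, hright, hcancel]
  abel

/-- Each truncated Casimir operator commutes with the truncated Casimir sum. -/
lemma commute_sum (h : IsDualRootFamily H B S x y) {α : Module.Dual ℂ H} (hα : α ∈ S)
    (hH : ∃ t : H, ⁅x α, y α⁆ = t) :
    Commute (ι ℂ (x α) * ι ℂ (y α) + ι ℂ (y α) * ι ℂ (x α))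
      (∑ β ∈ S, (ι ℂ (x β) * ι ℂ (y β) + ι ℂ (y β) * ι ℂ (x β))) := by
  have hrev : ∑ β ∈ S, ι ℂ (y β) * ι ℂ (x β) = ∑ β ∈ S, ι ℂ (x β) * ι ℂ (y β) := by
    refine Finset.sum_nbij' (-·) (-·) h.neg_mem h.neg_mem (by simp) (by simp) ?_
    exact fun β hβ ↦ (h.left_neg_mul_right_neg hβ).symm
  rw [Finset.sum_add_distrib, hrev]
  suffices hT : Commute (ι ℂ (x α) * ι ℂ (y α) + ι ℂ (y α) * ι ℂ (x α))
      (∑ β ∈ S, ι ℂ (x β) * ι ℂ (y β)) from hT.add_right hT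
  obtain ⟨t, ht⟩ := hH
  obtain ⟨r, s, hrs, hx, hy⟩ := h.exists_neg hα
  have hX := h.commutator_sum hα (h.left α hα)
  have hY := h.commutator_sum (h.neg_mem _ hα) (h.right α hα)
  have ht' : ⁅y α, x α⁆ = -(t : L) := by rw [← lie_skew, ht]
  rw [hx, hy, lie_smul, ι_smul, ι_smul, smul_mul_smul_comm, hrs, one_smul, ht] at hX
  rw [neg_neg, hx, hy, lie_smul, ι_smul, ι_smul, smul_mul_smul_comm, hrs, one_smul, ht',
    ι_neg] at hY
  have htX : ι ℂ (t : L) * ι ℂ (x α) - ι ℂ (x α) * ι ℂ (t : L) = α t • ι ℂ (x α) := by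
    rw [← ι_lie, h.left α hα t, ι_smul]
  have htY : ι ℂ (t : L) * ι ℂ (y α) - ι ℂ (y α) * ι ℂ (t : L) = -(α t • ι ℂ (y α)) := by
    rw [← ι_lie, h.right α hα t, ι_smul, LinearMap.neg_apply, neg_smul]
  generalize ∑ β ∈ S, ι ℂ (x β) * ι ℂ (y β) = T at *
  generalize ι ℂ (x α) = X at *
  generalize ι ℂ (y α) = Y at *
  generalize ι ℂ (t : L) = Z at *
  rw [commute_iff_eq, ← sub_eq_zero]
  calc (X * Y + Y * X) * T - T * (X * Y + Y * X)
      = X * (Y * T - T * Y) + (X * T - T * X) * Y + Y * (X * T - T * X)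
          + (Y * T - T * Y) * X := by noncomm_ring
    _ = (Z * X - X * Z) * Y + X * (Z * Y - Y * Z) - (Z * Y - Y * Z) * X
          - Y * (Z * X - X * Z) := by rw [hX, hY]; noncomm_ring
    _ = 0 := by
      rw [htX, htY]
      simp only [smul_mul_assoc, mul_smul_comm, mul_neg, neg_mul]
      abel

end IsDualRootFamily

/-- the rank-two commutation relations `[κ_α, Σ_{β ∈ R ∩ P} κ_β] = 0` for the
truncated Casimir operators, which by Kohno's criterion express the flatness of the Casimir
connection. -/
theorem casimir_rank_two_relations
    {L : Type} [LieRing L] [LieAlgebra ℂ L] [FiniteDimensional ℂ L]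
    [LieAlgebra.IsSemisimple ℂ L]
    (H : LieSubalgebra ℂ L) [H.IsCartanSubalgebra]
    -- a fixed nonzero multiple of the Killing form
    (c : ℂ) (hc : c ≠ 0)
    (B : LinearMap.BilinForm ℂ L) (hB : B = c • killingForm ℂ L)
    -- the set of roots
    (R : Set (Module.Dual ℂ H))
    (hR : R = {α | α ≠ 0 ∧ ∃ x : L, x ≠ 0 ∧ IsRootVector H α x})
    (hRfin : R.Finite)
    -- `t α ∈ h` represents the root `α` via the bilinear form
    (t : Module.Dual ℂ H → H)
    (ht : ∀ α ∈ R, ∀ x : H, B (t α) x = α x)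
    -- an `sl₂`-triple for each root, `h_α` being the coroot
    (e f : Module.Dual ℂ H → L) (hcoroot : Module.Dual ℂ H → H)
    (he : ∀ α ∈ R, IsRootVector H α (e α) ∧ e α ≠ 0)
    (hf : ∀ α ∈ R, IsRootVector H (-α) (f α) ∧ f α ≠ 0)
    (hef : ∀ α ∈ R, ⁅e α, f α⁆ = (hcoroot α : L))
    (hcoroot2 : ∀ α ∈ R, α (hcoroot α) = 2)
    -- the truncated Casimir operators κ_α = (⟨α,α⟩/2)·(e_α f_α + f_α e_α)
    (κ : Module.Dual ℂ H → UniversalEnvelopingAlgebra ℂ L)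
    (hκ : ∀ α ∈ R, κ α = (B (t α) (t α) / 2) •
      (ι ℂ (e α) * ι ℂ (f α) + ι ℂ (f α) * ι ℂ (e α))) :
    ∀ P : Submodule ℂ (Module.Dual ℂ H), Module.finrank ℂ P = 2 →
      ∀ α ∈ R ∩ (P : Set (Module.Dual ℂ H)),
        Commute (κ α) (∑ᶠ β ∈ R ∩ (P : Set (Module.Dual ℂ H)), κ β) := by
  intro P _ α hα
  have hinv : ∀ u v w, B ⁅u, v⁆ w = B u ⁅v, w⁆ := fun u v w ↦ by
    simp only [hB, LinearMap.smul_apply]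
    rw [killingForm, LieModule.traceForm_apply_lie_apply]
  have hsymm : ∀ u v, B u v = B v u := fun u v ↦ by
    simp only [hB, LinearMap.smul_apply]
    rw [killingForm, LieModule.traceForm_comm]
  have hmem {β : Module.Dual ℂ H} : β ∈ R ↔ β ≠ 0 ∧ ∃ x : L, x ≠ 0 ∧ IsRootVector H β x := by
    rw [hR]; rfl
  have hpair : ∀ β ∈ R, B (e β) ((B (t β) (t β) / 2) • f β) = 1 := fun β hβ ↦ by
    have h1 : B (t β) (hcoroot β) = B (t β) (t β) * B (e β) (f β) := by
      rw [← hef β hβ, ← hinv, (he β hβ).1, map_smul, LinearMap.smul_apply, ← ht β hβ (t β),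
        smul_eq_mul]
    rw [ht β hβ, hcoroot2 β hβ] at h1
    rw [map_smul, smul_eq_mul, div_mul_eq_mul_div, ← h1, div_self two_ne_zero]
  have hfin : (R ∩ (P : Set (Module.Dual ℂ H))).Finite := hRfin.subset Set.inter_subset_left
  have hS {β : Module.Dual ℂ H} : β ∈ hfin.toFinset ↔ β ∈ R ∧ β ∈ P := by simp
  have hneg : ∀ β ∈ R, -β ∈ R := fun β hβ ↦
    hmem.mpr ⟨neg_ne_zero.mpr (hmem.mp hβ).1, f β, (hf β hβ).2, (hf β hβ).1⟩
  have hfam : IsDualRootFamily H B hfin.toFinset e (fun β ↦ (B (t β) (t β) / 2) • f β) :=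
    { invariant := hinv
      symm := hsymm
      zero_notMem := fun h0 ↦ (hmem.mp (hS.mp h0).1).1 rfl
      neg_mem := fun β hβ ↦ hS.mpr ⟨hneg β (hS.mp hβ).1, P.neg_mem (hS.mp hβ).2⟩
      eq_zero := fun β hβ γ hγ hne hnot z hz ↦ by
        by_contra hz0
        exact hnot (hS.mpr ⟨hmem.mpr ⟨hne, z, hz0, hz⟩, P.add_mem (hS.mp hβ).2 (hS.mp hγ).2⟩)
      left := fun β hβ ↦ (he β (hS.mp hβ).1).1
      right := fun β hβ ↦ (hf β (hS.mp hβ).1).1.smul _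
      pairing := fun β hβ ↦ hpair β (hS.mp hβ).1
      eq_smul_left := fun β hβ z hz ↦ by
        have hβR := (hS.mp hβ).1
        obtain ⟨r, rfl⟩ := (he β hβR).1.exists_smul_eq (hmem.mp hβR).1 (he β hβR).2 hz
        rw [LinearMap.map_smul₂, hpair β hβR, smul_eq_mul, mul_one]
      eq_smul_right := fun β hβ z hz ↦ by
        have hβR := (hS.mp hβ).1
        have hp := hpair β hβR
        have hy0 : (B (t β) (t β) / 2) • f β ≠ 0 := fun h0 ↦ by simp [h0] at hp
        obtain ⟨r, rfl⟩ := ((hf β hβR).1.smul _).exists_smul_eq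
          (neg_ne_zero.mpr (hmem.mp hβR).1) hy0 hz
        rw [LinearMap.map_smul₂, hsymm _ (e β), hp, smul_eq_mul, mul_one] }
  have hκ' : ∀ β ∈ R, κ β = ι ℂ (e β) * ι ℂ ((B (t β) (t β) / 2) • f β) +
      ι ℂ ((B (t β) (t β) / 2) • f β) * ι ℂ (e β) := fun β hβ ↦ by
    rw [hκ β hβ, ι_smul, mul_smul_comm, smul_mul_assoc, smul_add]
  rw [finsum_mem_eq_finite_toFinset_sum _ hfin, hκ' α hα.1,
    Finset.sum_congr rfl fun β hβ ↦ hκ' β (hS.mp hβ).1]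
  refine hfam.commute_sum (hS.mpr hα) ⟨(B (t α) (t α) / 2) • hcoroot α, ?_⟩
  rw [lie_smul, hef α hα.1]
  rfl
end

section
/- Fix a system of positive roots R⁺ ⊆ R and let F be the free associative unital ℂ-algebra on generators {r_α}_{α∈R⁺}. Let Φ : F → U(g) be the unique algebra homomorphism with Φ(r_α) = κ_α, and let I ⊆ F be the two-sided ideal generated by all elements [r_α, Σ_{β ∈ R⁺ ∩ P} r_β], where P ranges over the two-dimensional subspaces of h* spanned by roots and α ranges over R⁺ ∩ P. If some simple ideal of g is not isomorphic to sl₂(ℂ), then the inclusion I ⊆ ker Φ is strict; equivalently, the induced homomorphism from the universal enveloping algebra of the holonomy Lie algebra of the root arrangement of g to U(g), sending r_α to κ_α, is not injective. -/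
open LieAlgebra UniversalEnvelopingAlgebra

section PolynomialGrowth

variable {K L ι' : Type*} [Field K] [LieRing L] [LieAlgebra K L]

/-- The span, in the enveloping algebra, of the products of at most `n` vectors of a family `b`. -/
def envelopingFiltration (b : ι' → L) (n : ℕ) : Submodule K (UniversalEnvelopingAlgebra K L) :=
  Submodule.span K {u | ∃ l : List ι', l.length ≤ n ∧ (l.map fun i ↦ ι K (b i)).prod = u}

lemma envelopingFiltration_mono (b : ι' → L) {m n : ℕ} (h : m ≤ n) :
    envelopingFiltration (K := K) b m ≤ envelopingFiltration b n :=
  Submodule.span_mono fun _ ⟨l, hl, hu⟩ ↦ ⟨l, hl.trans h, hu⟩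

lemma list_prod_mem_envelopingFiltration (b : ι' → L) {l : List ι'} {n : ℕ} (h : l.length ≤ n) :
    (l.map fun i ↦ ι K (b i)).prod ∈ envelopingFiltration b n :=
  Submodule.subset_span ⟨l, h, rfl⟩

lemma mul_mem_envelopingFiltration (b : ι' → L) {m n : ℕ} {u v : UniversalEnvelopingAlgebra K L}
    (hu : u ∈ envelopingFiltration b m) (hv : v ∈ envelopingFiltration b n) :
    u * v ∈ envelopingFiltration b (m + n) := by
  have h := Submodule.mul_mem_mul hu hv
  rw [envelopingFiltration, envelopingFiltration, Submodule.span_mul_span] at h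
  refine Submodule.span_mono ?_ h
  rintro _ ⟨_, ⟨l, hl, rfl⟩, _, ⟨l', hl', rfl⟩, rfl⟩
  exact ⟨l ++ l', by simp; omega, by simp⟩

attribute [local instance] LieRing.ofAssociativeRing in
lemma ι_lie_eq_sub (x y : L) : ι K ⁅x, y⁆ = ι K x * ι K y - ι K y * ι K x := by
  rw [LieHom.map_lie, LieRing.of_associative_ring_bracket]

lemma ι_mem_envelopingFiltration (b : Module.Basis ι' K L) (x : L) :
    ι K x ∈ envelopingFiltration (K := K) b 1 := by
  have hx : x ∈ Submodule.span K (Set.range b) := b.span_eq ▸ Submodule.mem_top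
  induction hx using Submodule.span_induction with
  | mem x hx =>
    obtain ⟨i, rfl⟩ := hx
    exact Submodule.subset_span ⟨[i], by simp⟩
  | zero => simp
  | add x y _ _ hx hy => simpa using add_mem hx hy
  | smul a x _ hx => simpa using Submodule.smul_mem _ a hx

lemma list_prod_sub_mem_envelopingFiltration (b : Module.Basis ι' K L) {l l' : List ι'}
    (h : l.Perm l') : ∀ {n : ℕ}, l.length ≤ n + 1 →
    (l.map fun i ↦ ι K (b i)).prod - (l'.map fun i ↦ ι K (b i)).prod ∈
      envelopingFiltration (K := K) b n := by
  induction h with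
  | nil => intro n _; simp
  | @cons x l l' h ih =>
    intro n hn
    rcases n with _ | n
    · obtain rfl : l = [] := by simpa using hn
      obtain rfl : l' = [] := by simpa using h
      simp
    · have := mul_mem_envelopingFiltration (K := K) b (ι_mem_envelopingFiltration b (b x))
        (ih (n := n) (by simpa using hn))
      rw [add_comm, mul_sub] at this
      simpa using this
  | swap x y l =>
    intro n hn
    have := mul_mem_envelopingFiltration (K := K) b (ι_mem_envelopingFiltration b ⁅b y, b x⁆)
        (list_prod_mem_envelopingFiltration b le_rfl (l := l))
    refine envelopingFiltration_mono (K := K) b (m := 1 + l.length) (by simp at hn; omega) ?_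
    rw [ι_lie_eq_sub, sub_mul] at this
    simpa [mul_assoc] using this
  | trans h₁ h₂ ih₁ ih₂ =>
    intro n hn
    simpa using add_mem (ih₁ hn) (ih₂ (h₁.length_eq ▸ hn))

/-- The weak half of the Poincaré–Birkhoff–Witt theorem: ordered monomials span. -/
lemma envelopingFiltration_le_span_multiset (b : Module.Basis ι' K L) (n : ℕ) :
    envelopingFiltration (K := K) b n ≤ Submodule.span K
      {u | ∃ s : Multiset ι', s.card ≤ n ∧ (s.toList.map fun i ↦ ι K (b i)).prod = u} := by
  induction n with
  | zero =>
    refine Submodule.span_le.2 ?_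
    rintro _ ⟨l, hl, rfl⟩
    obtain rfl : l = [] := by simpa using hl
    exact Submodule.subset_span ⟨0, by simp⟩
  | succ n ih =>
    refine Submodule.span_le.2 ?_
    rintro _ ⟨l, hl, rfl⟩
    have hp : l.Perm (l : Multiset ι').toList := Multiset.coe_eq_coe.1 (Multiset.coe_toList _).symm
    rw [SetLike.mem_coe, ← sub_add_cancel (l.map fun i ↦ ι K (b i)).prod]
    refine add_mem (Submodule.span_mono ?_ (ih (list_prod_sub_mem_envelopingFiltration b hp hl)))
      (Submodule.subset_span ⟨(l : Multiset ι'), by simpa using hl, rfl⟩)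
    exact fun _ ⟨s, hs, hu⟩ ↦ ⟨s, hs.trans n.le_succ, hu⟩

lemma exists_envelopingFiltration_le_span_range [Fintype ι'] (b : Module.Basis ι' K L) (n : ℕ) :
    ∃ g : (ι' → Fin (n + 1)) → UniversalEnvelopingAlgebra K L,
      envelopingFiltration (K := K) b n ≤ Submodule.span K (Set.range g) := by
  classical
  refine ⟨fun c ↦ ((∑ i, (c i : ℕ) • ({i} : Multiset ι')).toList.map fun i ↦ ι K (b i)).prod,
    (envelopingFiltration_le_span_multiset b n).trans (Submodule.span_mono ?_)⟩
  rintro _ ⟨s, hs, rfl⟩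
  refine ⟨fun i ↦ ⟨s.count i, Nat.lt_succ_of_le ((s.count_le_card i).trans hs)⟩, ?_⟩
  have : ∑ i, s.count i • ({i} : Multiset ι') = s := by
    ext j
    simp [Multiset.count_sum', Multiset.count_singleton]
  simp [this]

lemma linearIndependent_freeAlgebra_words (X : Type*) (m : ℕ) :
    LinearIndependent K fun s : Fin m → X ↦ ((List.ofFn s).map (FreeAlgebra.ι K)).prod := by
  let E := FreeAlgebra.equivMonoidAlgebraFreeMonoid (R := K) (X := X)
  have hE (l : List X) : E (l.map (FreeAlgebra.ι K)).prod =
      MonoidAlgebra.of K (FreeMonoid X) (FreeMonoid.ofList l) := by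
    induction l with
    | nil => rw [List.map_nil, List.prod_nil, map_one, FreeMonoid.ofList_nil, map_one]
    | cons x l ih =>
      rw [List.map_cons, List.prod_cons, map_mul, ih, FreeMonoid.ofList_cons, map_mul]
      simp [E, FreeAlgebra.equivMonoidAlgebraFreeMonoid]
  have hli : LinearIndependent K (MonoidAlgebra.of K (FreeMonoid X)) :=
    LinearIndependent.of_comp (MonoidAlgebra.coeffLinearEquiv K).toLinearMap
      (Finsupp.linearIndependent_single_one K (FreeMonoid X))
  have h := hli.comp (fun s : Fin m → X ↦ FreeMonoid.ofList (List.ofFn s))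
    (FreeMonoid.ofList.injective.comp List.ofFn_injective)
  simp only [Function.comp_def, ← hE] at h
  exact LinearIndependent.of_comp E.toLinearMap h

lemma exists_mul_add_one_pow_lt_two_pow (k d : ℕ) : ∃ m : ℕ, (k * m + 1) ^ d < 2 ^ m := by
  have h := (tendsto_pow_const_div_const_pow_of_one_lt d (one_lt_two (α := ℝ))).eventually
    (gt_mem_nhds (show (0 : ℝ) < ((k + 1 : ℝ) ^ d)⁻¹ by positivity))
  obtain ⟨m, hm, hm1⟩ := (h.and (Filter.eventually_ge_atTop 1)).exists
  refine ⟨m, ?_⟩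
  rw [div_lt_iff₀ (by positivity), inv_mul_eq_div, lt_div_iff₀ (by positivity), ← mul_pow] at hm
  have h2 : (k * m + 1) ^ d ≤ (m * (k + 1)) ^ d := Nat.pow_le_pow_left (by nlinarith) d
  exact h2.trans_lt (by exact_mod_cast hm)

/-- An enveloping algebra of a finite-dimensional Lie algebra has polynomial growth, so it has no
free subalgebra on two generators. -/
theorem not_injective_freeAlgebra_enveloping [Finite ι'] (b : Module.Basis ι' K L) (k : ℕ)
    (φ : FreeAlgebra K Bool →ₐ[K] UniversalEnvelopingAlgebra K L)
    (hφ : ∀ x, φ (FreeAlgebra.ι K x) ∈ envelopingFiltration b k) :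
    ¬ Function.Injective φ := by
  classical
  intro hinj
  have := Fintype.ofFinite ι'
  obtain ⟨m, hm⟩ := exists_mul_add_one_pow_lt_two_pow k (Fintype.card ι')
  have hmem (l : List Bool) :
      φ (l.map (FreeAlgebra.ι K)).prod ∈ envelopingFiltration b (k * l.length) := by
    induction l with
    | nil => simpa using list_prod_mem_envelopingFiltration (K := K) b (l := []) (n := 0) le_rfl
    | cons x l ih =>
      have := mul_mem_envelopingFiltration b (hφ x) ih
      rw [List.length_cons, mul_add, mul_one, add_comm]
      simpa using this
  obtain ⟨g, hg⟩ := exists_envelopingFiltration_le_span_range (K := K) b (k * m)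
  have hli := (linearIndependent_freeAlgebra_words (K := K) Bool m).map' φ.toLinearMap
    (LinearMap.ker_eq_bot.2 hinj)
  have hle := linearIndependent_le_span_aux' _ hli (Set.range g) ?_
  · have := hle.trans (Fintype.card_range_le g)
    simp only [Fintype.card_fun, Fintype.card_fin, Fintype.card_bool] at this
    omega
  · rintro _ ⟨s, rfl⟩
    exact hg (by simpa using hmem (List.ofFn s))

end PolynomialGrowth

section TruncatedCasimir

/-- Two families of root vectors `x β ∈ g β`, `y β ∈ g (-β)`, indexed by a finite symmetric set
`S` of roots of a graded Lie algebra, that are dual for an invariant symmetric form. -/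
structure IsDualRootFamily_s1 {K L G : Type*} [Field K] [LieRing L] [LieAlgebra K L] [AddCommGroup G]
    (g : G → Submodule K L) (B : LinearMap.BilinForm K L) (S : Finset G) (x y : G → L) :
    Prop where
  lie_mem : ∀ {α β a b}, a ∈ g α → b ∈ g β → ⁅a, b⁆ ∈ g (α + β)
  lie_apply : ∀ a b c, B ⁅a, b⁆ c = B a ⁅b, c⁆
  symm : ∀ a b, B a b = B b a
  mem_left : ∀ {β}, β ∈ S → x β ∈ g β
  mem_right : ∀ {β}, β ∈ S → y β ∈ g (-β)
  apply_eq_one : ∀ {β}, β ∈ S → B (x β) (y β) = 1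
  eq_smul_left : ∀ {β}, β ∈ S → ∀ a ∈ g β, a = B a (y β) • x β
  eq_bot : ∀ {α β}, α ∈ S → β ∈ S → α + β ∉ S → α + β ≠ 0 → g (α + β) = ⊥
  neg_mem : ∀ {α}, α ∈ S → -α ∈ S
  zero_notMem : 0 ∉ S

namespace IsDualRootFamily_s1

variable {K L G : Type*} [Field K] [LieRing L] [LieAlgebra K L] [AddCommGroup G]
  {g : G → Submodule K L} {B : LinearMap.BilinForm K L} {S : Finset G} {x y : G → L}

lemma apply_neg_mul (h : IsDualRootFamily_s1 g B S x y) {β : G} (hβ : β ∈ S) :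
    B (x (-β)) (x β) * B (y (-β)) (y β) = 1 := by
  have h₁ := h.eq_smul_left hβ (y (-β)) (by simpa using h.mem_right (h.neg_mem hβ))
  have h₂ := h.apply_eq_one (h.neg_mem hβ)
  rw [h₁] at h₂
  simpa [mul_comm] using h₂

lemma eq_smul_right (h : IsDualRootFamily_s1 g B S x y) {β : G} (hβ : β ∈ S) {a : L}
    (ha : a ∈ g (-β)) : a = B (x β) a • y β := by
  have hx := h.eq_smul_left (h.neg_mem hβ) a ha
  have hy := h.eq_smul_left (h.neg_mem hβ) (y β) (h.mem_right hβ)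
  have h₁ : B (x β) a = B a (y (-β)) * B (x (-β)) (x β) := by
    conv_lhs => rw [hx]
    simp [h.symm (x β)]
  rw [h₁]
  conv_rhs => rw [hy]
  conv_lhs => rw [hx]
  rw [smul_smul, mul_assoc, h.symm (y β), h.apply_neg_mul hβ, mul_one]

lemma left_neg_eq (h : IsDualRootFamily_s1 g B S x y) {β : G} (hβ : β ∈ S) :
    x (-β) = B (x β) (x (-β)) • y β :=
  h.eq_smul_right hβ (h.mem_left (h.neg_mem hβ))

lemma right_neg_eq (h : IsDualRootFamily_s1 g B S x y) {β : G} (hβ : β ∈ S) :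
    y (-β) = B (y (-β)) (y β) • x β :=
  h.eq_smul_left hβ _ (by simpa using h.mem_right (h.neg_mem hβ))

lemma ι_neg_mul_ι_neg (h : IsDualRootFamily_s1 g B S x y) {β : G} (hβ : β ∈ S) :
    ι K (x (-β)) * ι K (y (-β)) = ι K (y β) * ι K (x β) := by
  rw [h.left_neg_eq hβ, h.right_neg_eq hβ, map_smul, map_smul, smul_mul_smul_comm,
    h.symm (x β), h.apply_neg_mul hβ, one_smul]

lemma lie_neg_eq (h : IsDualRootFamily_s1 g B S x y) {β : G} (hβ : β ∈ S) :
    ⁅x (-β), y (-β)⁆ = ⁅y β, x β⁆ := by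
  rw [h.left_neg_eq hβ, h.right_neg_eq hβ, smul_lie, lie_smul, smul_smul,
    h.symm (x β), h.apply_neg_mul hβ, one_smul]

lemma sum_erase_eq_zero [DecidableEq G] (h : IsDualRootFamily_s1 g B S x y) {α : G} (hα : α ∈ S)
    {a : L} (ha : a ∈ g α) :
    ∑ β ∈ S.erase (-α), ι K ⁅a, x β⁆ * ι K (y β) + ∑ β ∈ S.erase α, ι K (x β) * ι K ⁅a, y β⁆ =
      0 := by
  have h₁ : ∑ β ∈ S with α + β ∈ S, ι K ⁅a, x β⁆ * ι K (y β) =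
      ∑ β ∈ S.erase (-α), ι K ⁅a, x β⁆ * ι K (y β) := by
    refine Finset.sum_subset (fun β hβ ↦ ?_) fun β hβ hβ' ↦ ?_
    · rw [Finset.mem_filter] at hβ
      refine Finset.mem_erase.2 ⟨?_, hβ.1⟩
      rintro rfl
      exact h.zero_notMem (by simpa using hβ.2)
    · rw [Finset.mem_erase] at hβ
      have := h.lie_mem ha (h.mem_left hβ.2)
      rw [h.eq_bot hα hβ.2 (fun h' ↦ hβ' (Finset.mem_filter.2 ⟨hβ.2, h'⟩))
        (fun h' ↦ hβ.1 (eq_neg_of_add_eq_zero_right h')), Submodule.mem_bot] at this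
      simp [this]
  have h₂ : ∑ β ∈ S with -α + β ∈ S, ι K (x β) * ι K ⁅a, y β⁆ =
      ∑ β ∈ S.erase α, ι K (x β) * ι K ⁅a, y β⁆ := by
    refine Finset.sum_subset (fun β hβ ↦ ?_) fun β hβ hβ' ↦ ?_
    · rw [Finset.mem_filter] at hβ
      refine Finset.mem_erase.2 ⟨?_, hβ.1⟩
      rintro rfl
      exact h.zero_notMem (by simpa using hβ.2)
    · rw [Finset.mem_erase] at hβ
      have := h.lie_mem ha (h.mem_right hβ.2)
      rw [h.eq_bot hα (h.neg_mem hβ.2) (fun h' ↦ hβ' (Finset.mem_filter.2 ⟨hβ.2, ?_⟩))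
        (fun h' ↦ hβ.1 ?_), Submodule.mem_bot] at this
      · simp [this]
      · simpa [add_comm] using h.neg_mem h'
      · rw [← sub_eq_add_neg, sub_eq_zero] at h'
        exact h'.symm
  have h₃ : ∑ β ∈ S with α + β ∈ S, ι K ⁅a, x β⁆ * ι K (y β) =
      ∑ β ∈ S with -α + β ∈ S, -(ι K (x β) * ι K ⁅a, y β⁆) := by
    refine Finset.sum_bij' (fun β _ ↦ α + β) (fun β _ ↦ -α + β) ?_ ?_ ?_ ?_ fun β hβ ↦ ?_
    · simp +contextual
    · simp +contextual
    · simp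
    · simp
    · rw [Finset.mem_filter] at hβ
      have e₁ := h.eq_smul_left hβ.2 _ (h.lie_mem ha (h.mem_left hβ.1))
      have e₂ := h.eq_smul_right (a := ⁅a, y (α + β)⁆) hβ.1
        (by simpa using h.lie_mem ha (h.mem_right hβ.2))
      rw [← h.lie_apply, ← lie_skew (x β), map_neg, LinearMap.neg_apply] at e₂
      rw [e₁, e₂]
      simp
  rw [← h₁, ← h₂, h₃, Finset.sum_neg_distrib, neg_add_cancel]

/-- The commutator of a root vector with the truncated Casimir operator of a root subsystem. -/
lemma ι_mul_sum_sub_sum_mul_ι (h : IsDualRootFamily_s1 g B S x y) {α : G} (hα : α ∈ S) {a : L}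
    (ha : a ∈ g α) :
    ι K a * (∑ β ∈ S, ι K (x β) * ι K (y β)) - (∑ β ∈ S, ι K (x β) * ι K (y β)) * ι K a =
      ι K ⁅x α, y α⁆ * ι K a + ι K a * ι K ⁅x α, y α⁆ := by
  classical
  have h₁ : ι K a * (∑ β ∈ S, ι K (x β) * ι K (y β)) -
      (∑ β ∈ S, ι K (x β) * ι K (y β)) * ι K a =
      ∑ β ∈ S, ι K ⁅a, x β⁆ * ι K (y β) + ∑ β ∈ S, ι K (x β) * ι K ⁅a, y β⁆ := by
    rw [Finset.mul_sum, Finset.sum_mul, ← Finset.sum_sub_distrib, ← Finset.sum_add_distrib]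
    refine Finset.sum_congr rfl fun β _ ↦ ?_
    rw [ι_lie_eq_sub, ι_lie_eq_sub]
    noncomm_ring
  have ea := h.eq_smul_left hα a ha
  have h₂ : ι K ⁅a, x (-α)⁆ * ι K (y (-α)) = ι K ⁅x α, y α⁆ * ι K a := by
    have h₃ : ι K ⁅a, x (-α)⁆ * ι K (y (-α)) = ι K ⁅a, y α⁆ * ι K (x α) := by
      rw [h.left_neg_eq hα, h.right_neg_eq hα, lie_smul, map_smul, map_smul, smul_mul_smul_comm,
        h.symm (x α), h.apply_neg_mul hα, one_smul]
    rw [h₃, ea]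
    simp
  have h₃ : ι K (x α) * ι K ⁅a, y α⁆ = ι K a * ι K ⁅x α, y α⁆ := by
    rw [ea]
    simp
  rw [h₁, ← Finset.add_sum_erase _ _ (h.neg_mem hα), ← Finset.add_sum_erase _ _ hα, h₂, h₃,
    add_add_add_comm, h.sum_erase_eq_zero hα ha, add_zero]

lemma commute_truncatedCasimir_sum (h : IsDualRootFamily_s1 g B S x y) {α : G} (hα : α ∈ S) :
    Commute (ι K (x α) * ι K (y α) + ι K (y α) * ι K (x α))
      (∑ β ∈ S, ι K (x β) * ι K (y β)) := by
  have hx := h.ι_mul_sum_sub_sum_mul_ι hα (h.mem_left hα)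
  have hy := h.ι_mul_sum_sub_sum_mul_ι (h.neg_mem hα) (h.mem_right hα)
  rw [h.lie_neg_eq hα, ι_lie_eq_sub] at hy
  rw [ι_lie_eq_sub] at hx
  generalize (∑ β ∈ S, ι K (x β) * ι K (y β)) = C at *
  generalize ι K (x α) = X at *
  generalize ι K (y α) = Y at *
  have e : (X * Y + Y * X) * C - C * (X * Y + Y * X) =
      X * (Y * C - C * Y) + (X * C - C * X) * Y + Y * (X * C - C * X) + (Y * C - C * Y) * X := by
    noncomm_ring
  rw [hx, hy] at e
  rw [commute_iff_eq, ← sub_eq_zero, e]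
  noncomm_ring

end IsDualRootFamily_s1

end TruncatedCasimir

section SlTwo

/-- A Lie ideal spanned by an `sl₂`-triple is isomorphic to `sl₂`. -/
lemma IsSl2Triple.nonempty_lieEquiv_sl {K L : Type*} [Field K] [CharZero K] [LieRing L]
    [LieAlgebra K L] {h e f : L} (t : IsSl2Triple h e f) (J : LieIdeal K L)
    (hJ : ∀ x, x ∈ J ↔ ∃ c₁ c₂ c₃ : K, x = c₁ • e + c₂ • f + c₃ • ⁅e, f⁆) :
    Nonempty (J ≃ₗ⁅K⁆ LieAlgebra.SpecialLinear.sl (Fin 2) K) := by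
  have htr (A : LieAlgebra.SpecialLinear.sl (Fin 2) K) : A.1 1 1 = -A.1 0 0 := by
    have : Matrix.trace A.1 = 0 := A.2
    rw [Matrix.trace_fin_two] at this
    exact eq_neg_of_add_eq_zero_right this
  have he := t.lie_h_e_smul K
  have hf := t.lie_lie_smul_f K
  have he' : ⁅e, h⁆ = -(2 : K) • e := by rw [← lie_skew, he, neg_smul]
  have hf' : ⁅f, h⁆ = (2 : K) • f := by rw [← lie_skew, hf, neg_neg]
  have hfe : ⁅f, e⁆ = -h := by rw [← lie_skew, t.lie_e_f]
  let ψ : LieAlgebra.SpecialLinear.sl (Fin 2) K →ₗ⁅K⁆ J :=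
    { toFun := fun A ↦ ⟨A.1 0 1 • e + A.1 1 0 • f + A.1 0 0 • h,
        (hJ _).2 ⟨_, _, _, by rw [t.lie_e_f]⟩⟩
      map_add' := fun A A' ↦ by
        ext1
        change (A.1 0 1 + A'.1 0 1) • e + (A.1 1 0 + A'.1 1 0) • f + (A.1 0 0 + A'.1 0 0) • h =
          A.1 0 1 • e + A.1 1 0 • f + A.1 0 0 • h +
            (A'.1 0 1 • e + A'.1 1 0 • f + A'.1 0 0 • h)
        module
      map_smul' := fun a A ↦ by
        ext1
        change (a * A.1 0 1) • e + (a * A.1 1 0) • f + (a * A.1 0 0) • h =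
          a • (A.1 0 1 • e + A.1 1 0 • f + A.1 0 0 • h)
        module
      map_lie' := fun {A A'} ↦ by
        ext1
        change _ = ⁅A.1 0 1 • e + A.1 1 0 • f + A.1 0 0 • h,
          A'.1 0 1 • e + A'.1 1 0 • f + A'.1 0 0 • h⁆
        simp only [SpecialLinear.sl_bracket, Matrix.sub_apply, Matrix.mul_apply,
          Fin.sum_univ_two, htr, lie_add, add_lie, lie_smul, smul_lie, lie_self, t.lie_e_f, he, hf,
          he', hf', hfe]
        module }
  have hψ (A) : (ψ A : L) = A.1 0 1 • e + A.1 1 0 • f + A.1 0 0 • h := rfl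
  refine ⟨(LieEquiv.ofBijective ψ ⟨?_, fun x ↦ ?_⟩).symm⟩
  · refine (injective_iff_map_eq_zero _).2 fun A hA ↦ ?_
    have h₀ : A.1 0 1 • e + A.1 1 0 • f + A.1 0 0 • h = 0 := by rw [← hψ, hA]; rfl
    have h₁ : A.1 0 1 • e - A.1 1 0 • f = 0 := by
      have := congrArg (fun z ↦ (2 : K)⁻¹ • ⁅h, z⁆) h₀
      simp only [lie_add, lie_smul, he, hf, lie_self, lie_zero, smul_zero] at this
      rw [← this]
      module
    have h₂ : A.1 0 1 • e + A.1 1 0 • f = 0 := by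
      have := congrArg (fun z ↦ (2 : K)⁻¹ • ⁅h, z⁆) h₁
      simp only [lie_sub, lie_smul, he, hf, lie_zero, smul_zero] at this
      rw [← this]
      module
    have e₁ : A.1 0 1 = 0 := by
      refine (smul_eq_zero_iff_left t.e_ne_zero).1 ?_
      have : A.1 0 1 • e = (2 : K)⁻¹ • ((A.1 0 1 • e - A.1 1 0 • f) +
          (A.1 0 1 • e + A.1 1 0 • f)) := by module
      rw [this, h₁, h₂, add_zero, smul_zero]
    have e₂ : A.1 1 0 = 0 := by
      refine (smul_eq_zero_iff_left t.f_ne_zero).1 ?_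
      have : A.1 1 0 • f = (2 : K)⁻¹ • ((A.1 0 1 • e + A.1 1 0 • f) -
          (A.1 0 1 • e - A.1 1 0 • f)) := by module
      rw [this, h₁, h₂, sub_zero, smul_zero]
    have e₃ : A.1 0 0 = 0 := by
      refine (smul_eq_zero_iff_left t.h_ne_zero).1 ?_
      rw [← h₀, e₁, e₂]
      module
    ext i j
    fin_cases i <;> fin_cases j <;> simp [e₁, e₂, e₃, htr]
  · obtain ⟨c₁, c₂, c₃, hx⟩ := (hJ x).1 x.2
    refine ⟨⟨!![c₃, c₁; c₂, -c₃], ?_⟩, ?_⟩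
    · exact LinearMap.mem_ker.2 (by simp [Matrix.trace_fin_two])
    · ext1
      rw [hx, hψ, t.lie_e_f]
      simp

end SlTwo

section Roots

open LieAlgebra.IsKilling LieModule

variable {K L : Type*} [Field K] [CharZero K] [LieRing L] [LieAlgebra K L]
  [FiniteDimensional K L] [IsKilling K L] {H : LieSubalgebra K L} [H.IsCartanSubalgebra]
  [IsTriangularizable K H L]

/-- In a semisimple Lie algebra, a simple ideal all of whose roots are pairwise orthogonal is
isomorphic to `sl₂`. -/
lemma nonempty_lieEquiv_sl_of_orthogonal (J : LieIdeal K L) [IsSimple K J]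
    (hno : ∀ α β : H.root, α ≠ β → α.1 ≠ -β.1 → (rootSystem H).pairing α β = 0) :
    Nonempty (J ≃ₗ⁅K⁆ LieAlgebra.SpecialLinear.sl (Fin 2) K) := by
  have hJ : J ≠ ⊥ := by
    rintro rfl
    exact IsSimple.non_abelian K (L := (⊥ : LieIdeal K L)) inferInstance
  obtain ⟨α, hα⟩ : J.rootSet (H := H) |>.Nonempty := by
    by_contra! h
    refine hJ ?_
    have := J.restr_eq_iSup_sl2SubmoduleOfRoot (H := H)
    simp only [h, Set.mem_empty_iff_false, iSup_false, iSup_bot] at this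
    rw [← LieSubmodule.toSubmodule_inj, ← LieSubmodule.restr_toSubmodule J H, this]
    rfl
  have hα0 := H.isNonZero_coe_root α
  have hroot {β : Weight K H L} (hβ : β.IsNonZero)
      (h : β.toLinear ∈ Submodule.span K {α.1.toLinear}) : β = -α.1 ∨ β = α.1 := by
    obtain ⟨k, hk⟩ := Submodule.mem_span_singleton.1 h
    exact eq_neg_or_eq_of_eq_smul _ _ hβ k (by ext x; simpa using (LinearMap.congr_fun hk x).symm)
  have hq : ∀ i, Submodule.span K {α.1.toLinear} ∈
      Module.End.invtSubmodule ((rootSystem H).reflection i).toLinearMap := by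
    intro i
    rw [Module.End.mem_invtSubmodule, Submodule.span_le, Set.singleton_subset_iff]
    change (rootSystem H).reflection i ((rootSystem H).root α) ∈ Submodule.span K {α.1.toLinear}
    have hmem : (rootSystem H).root α ∈ Submodule.span K {α.1.toLinear} :=
      Submodule.mem_span_singleton_self _
    rw [RootPairing.reflection_apply_root]
    refine Submodule.sub_mem _ hmem ?_
    rcases eq_or_ne α i with rfl | h₁
    · exact Submodule.smul_mem _ _ hmem
    · by_cases h₂ : α.1 = -i.1
      · have : (rootSystem H).root i = -(rootSystem H).root α := by
          ext x
          simp [h₂]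
        rw [this]
        exact Submodule.smul_mem _ _ (Submodule.neg_mem _ hmem)
      · rw [hno α i h₁ h₂, zero_smul]
        exact Submodule.zero_mem _
  set I := invtSubmoduleToLieIdeal _ hq
  have hI : I.restr H = sl2SubmoduleOfRoot hα0 := by
    rw [restr_invtSubmoduleToLieIdeal_eq_iSup]
    refine le_antisymm (iSup_le fun ⟨β, hβ, hβ0⟩ ↦ ?_)
      (le_iSup_of_le ⟨α.1, Submodule.mem_span_singleton_self _, hα0⟩ le_rfl)
    rcases hroot hβ0 hβ with rfl | rfl
    · intro x hx
      obtain ⟨h, e, f, t, he, hf⟩ := exists_isSl2Triple_of_weight_isNonZero hα0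
      have he' : e ∈ rootSpace H (-(-α.1 : Weight K H L)) := by simpa using he
      have hf' : f ∈ rootSpace H (-α.1 : Weight K H L) := by simpa using hf
      obtain ⟨c₁, c₂, c₃, rfl⟩ := (mem_sl2SubalgebraOfRoot_iff hβ0 t.symm hf' he').1 hx
      refine (mem_sl2SubalgebraOfRoot_iff hα0 t he hf).2 ⟨c₂, c₁, -c₃, ?_⟩
      rw [← lie_skew f e, smul_neg, neg_smul, add_comm (c₁ • f)]
    · exact le_rfl
  have hIJ : I ≤ J := by
    change I.restr H ≤ J.restr H
    rw [hI, J.restr_eq_iSup_sl2SubmoduleOfRoot (H := H)]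
    exact le_iSup₂_of_le α hα le_rfl
  have hI0 : I ≠ ⊥ := by
    intro h
    refine sl2SubmoduleOfRoot_ne_bot _ hα0 (hI ▸ ?_)
    rw [h]
    rfl
  have hJI : J ≤ I := by
    rcases IsSimple.eq_bot_or_eq_top (R := K) (LieIdeal.comap J.incl I) with h | h
    · refine (hI0 ((LieSubmodule.eq_bot_iff _).2 fun x hx ↦ ?_)).elim
      have : (⟨x, hIJ hx⟩ : J) ∈ LieIdeal.comap J.incl I := by simpa using hx
      rw [h, LieSubmodule.mem_bot] at this
      exact congrArg Subtype.val this
    · intro x hx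
      have : (⟨x, hx⟩ : J) ∈ LieIdeal.comap J.incl I := h ▸ LieSubmodule.mem_top _
      simpa using this
  obtain ⟨h, e, f, t, he, hf⟩ := exists_isSl2Triple_of_weight_isNonZero hα0
  refine t.nonempty_lieEquiv_sl J fun x ↦ ?_
  rw [← mem_sl2SubalgebraOfRoot_iff hα0 t he hf, le_antisymm hJI hIJ]
  change x ∈ I.restr H ↔ x ∈ sl2SubmoduleOfRoot hα0
  rw [hI]

/-- A semisimple Lie algebra with a simple ideal other than `sl₂` has two non-proportional roots
whose sum is a root. -/
lemma exists_weight_add_of_isEmpty_lieEquiv_sl (J : LieIdeal K L) [IsSimple K J]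
    (hJ : IsEmpty (J ≃ₗ⁅K⁆ LieAlgebra.SpecialLinear.sl (Fin 2) K)) :
    ∃ α β γ : Weight K H L, α.IsNonZero ∧ β.IsNonZero ∧ γ.IsNonZero ∧
      γ.toLinear = α.toLinear + β.toLinear ∧ ∀ k : K, β.toLinear ≠ k • α.toLinear := by
  obtain ⟨α, β, hne, hne', hp⟩ : ∃ α β : H.root, α ≠ β ∧ α.1 ≠ -β.1 ∧
      (rootSystem H).pairing α β ≠ 0 := by
    by_contra! h
    exact hJ.false (nonempty_lieEquiv_sl_of_orthogonal J h).some
  have hα0 := H.isNonZero_coe_root α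
  have hβ0 := H.isNonZero_coe_root β
  have hk (k : K) : β.1.toLinear ≠ k • α.1.toLinear := by
    intro h
    rcases eq_neg_or_eq_of_eq_smul α.1 β.1 hβ0 k
      (by ext x; simpa using LinearMap.congr_fun h x) with h | h
    · exact hne' (by rw [h, neg_neg])
    · exact hne (Subtype.ext h.symm)
  rw [← (rootSystem H).algebraMap_pairingIn ℤ, ne_eq, algebraMap_int_eq, eq_intCast,
    Int.cast_eq_zero] at hp
  rcases lt_or_gt_of_ne hp with hp | hp
  · obtain ⟨γ, hγ⟩ := (rootSystem H).root_add_root_mem_of_pairingIn_neg hp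
      (fun h ↦ hk (-1) (by
        ext x
        simpa [eq_neg_iff_add_eq_zero, add_comm] using LinearMap.congr_fun h x))
    exact ⟨α, β, γ, hα0, hβ0, H.isNonZero_coe_root γ, hγ, hk⟩
  · obtain ⟨γ, hγ⟩ := (rootSystem H).root_sub_root_mem_of_pairingIn_pos hp hne
    refine ⟨α, -β, γ, hα0, hβ0.neg, H.isNonZero_coe_root γ, ?_, fun k h ↦ hk (-k) ?_⟩
    · simpa [sub_eq_add_neg] using hγ
    · ext x
      simpa [neg_eq_iff_eq_neg] using LinearMap.congr_fun h x

end Roots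

section FreeAlgebraQuotient

/-- A retraction of a free algebra onto a free algebra on two generators, compatible with the
holonomy relations of any family of sets of generators that contains the third of the generators
`b₁`, `b₂`, `b₃` whenever it contains two of them. -/
lemma exists_algHom_freeAlgebra_bool {K X : Type*} [Field K] [Finite X] {b₁ b₂ b₃ : X}
    (h₁₂ : b₁ ≠ b₂) (h₁₃ : b₁ ≠ b₃) (h₂₃ : b₂ ≠ b₃) :
    ∃ π : FreeAlgebra K X →ₐ[K] FreeAlgebra K Bool,
      π (FreeAlgebra.ι K b₁) = FreeAlgebra.ι K true ∧
      π (FreeAlgebra.ι K b₂) = FreeAlgebra.ι K false ∧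
      ∀ T : Set X, (b₁ ∈ T → b₂ ∈ T → b₃ ∈ T) → (b₁ ∈ T → b₃ ∈ T → b₂ ∈ T) →
        (b₂ ∈ T → b₃ ∈ T → b₁ ∈ T) → ∀ a ∈ T,
        Commute (π (FreeAlgebra.ι K a)) (π (∑ᶠ b ∈ T, FreeAlgebra.ι K b)) := by
  classical
  let w : X → FreeAlgebra K Bool := fun b ↦
    if b = b₁ then FreeAlgebra.ι K true else if b = b₂ then FreeAlgebra.ι K false
    else if b = b₃ then -(FreeAlgebra.ι K true + FreeAlgebra.ι K false) else 0
  have w₁ : w b₁ = FreeAlgebra.ι K true := by simp [w]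
  have w₂ : w b₂ = FreeAlgebra.ι K false := by simp [w, h₁₂.symm]
  have w₃ : w b₃ = -(FreeAlgebra.ι K true + FreeAlgebra.ι K false) := by
    simp [w, h₁₃.symm, h₂₃.symm]
  have w₀ {b : X} (hb₁ : b ≠ b₁) (hb₂ : b ≠ b₂) (hb₃ : b ≠ b₃) : w b = 0 := by
    simp [w, hb₁, hb₂, hb₃]
  have hπ (b : X) : FreeAlgebra.lift K w (FreeAlgebra.ι K b) = w b := FreeAlgebra.lift_ι_apply w b
  refine ⟨FreeAlgebra.lift K w, by rw [hπ, w₁], by rw [hπ, w₂], fun T h₃ h₂ h₁ a ha ↦ ?_⟩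
  have hT := T.toFinite
  rw [finsum_mem_eq_finite_toFinset_sum _ hT, map_sum, hπ]
  simp_rw [hπ]
  by_cases hall : b₁ ∈ T ∧ b₂ ∈ T ∧ b₃ ∈ T
  · have : ∑ b ∈ hT.toFinset, w b = 0 := by
      rw [← Finset.sum_subset (s₁ := {b₁, b₂, b₃})]
      · rw [Finset.sum_insert (by simp [h₁₂, h₁₃]), Finset.sum_pair h₂₃, w₁, w₂, w₃]
        abel
      · intro b hb
        simp only [Finset.mem_insert, Finset.mem_singleton] at hb
        rw [Set.Finite.mem_toFinset]
        rcases hb with rfl | rfl | rfl <;> tauto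
      · intro b _ hb
        simp only [Finset.mem_insert, Finset.mem_singleton, not_or] at hb
        exact w₀ hb.1 hb.2.1 hb.2.2
    rw [this]
    exact Commute.zero_right _
  · refine Commute.sum_right _ _ _ fun b hb ↦ ?_
    rw [Set.Finite.mem_toFinset] at hb
    rcases eq_or_ne a b with rfl | hab
    · exact Commute.refl _
    by_cases ha₀ : w a = 0
    · rw [ha₀]; exact Commute.zero_left _
    by_cases hb₀ : w b = 0
    · rw [hb₀]; exact Commute.zero_right _
    have ha' : a = b₁ ∨ a = b₂ ∨ a = b₃ := by by_contra! h; exact ha₀ (w₀ h.1 h.2.1 h.2.2)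
    have hb' : b = b₁ ∨ b = b₂ ∨ b = b₃ := by by_contra! h; exact hb₀ (w₀ h.1 h.2.1 h.2.2)
    refine (hall ?_).elim
    rcases ha' with rfl | rfl | rfl <;> rcases hb' with rfl | rfl | rfl <;> tauto

end FreeAlgebraQuotient

section RootVectors

open LieModule LieAlgebra.IsKilling

variable {L : Type} [LieRing L] [LieAlgebra ℂ L] [FiniteDimensional ℂ L]
  [LieAlgebra.IsSemisimple ℂ L] {H : LieSubalgebra ℂ L} [H.IsCartanSubalgebra]

lemma isRootVector_iff {α : Module.Dual ℂ H} {x : L} :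
    IsRootVector H α x ↔ x ∈ rootSpace H α :=
  ⟨fun h ↦ weightSpace_le_genWeightSpace L _ ((mem_weightSpace _ _).2 h),
    fun h ↦ lie_eq_smul_of_mem_rootSpace h⟩

lemma isRoot_iff {α : Module.Dual ℂ H} :
    (α ≠ 0 ∧ ∃ x : L, x ≠ 0 ∧ IsRootVector H α x) ↔
      ∃ χ : Weight ℂ H L, χ.IsNonZero ∧ χ.toLinear = α := by
  constructor
  · rintro ⟨hα, x, hx, hαx⟩
    rw [isRootVector_iff] at hαx
    refine ⟨⟨α, fun h ↦ hx ?_⟩, fun h ↦ hα ?_, rfl⟩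
    · have : x ∈ (⊥ : LieSubmodule ℂ H L) := h ▸ hαx
      exact (LieSubmodule.mem_bot _).1 this
    ext y
    exact congrFun h y
  · rintro ⟨χ, hχ, rfl⟩
    obtain ⟨x, hx, hx0⟩ := χ.exists_ne_zero
    refine ⟨fun h ↦ hχ ?_, x, hx0, isRootVector_iff.2 hx⟩
    ext y
    exact LinearMap.congr_fun h y

lemma finite_isRoot :
    {α : Module.Dual ℂ H | α ≠ 0 ∧ ∃ x : L, x ≠ 0 ∧ IsRootVector H α x}.Finite :=
  (Set.finite_range fun χ : Weight ℂ H L ↦ χ.toLinear).subset fun _ hα ↦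
    (isRoot_iff.1 hα).imp fun _ h ↦ h.2

lemma IsRootVector.exists_eq_smul {α : Module.Dual ℂ H} (hα : α ≠ 0) {x a : L} (hx₀ : x ≠ 0)
    (hx : IsRootVector H α x) (ha : IsRootVector H α a) : ∃ k : ℂ, a = k • x := by
  obtain ⟨χ, hχ, rfl⟩ := isRoot_iff.1 ⟨hα, x, hx₀, hx⟩
  rw [isRootVector_iff] at hx ha
  obtain ⟨k, hk⟩ := (finrank_eq_one_iff_of_nonzero' (⟨x, hx⟩ : rootSpace H χ)
    (fun h ↦ hx₀ (congrArg Subtype.val h))).1 (finrank_rootSpace_eq_one χ hχ) ⟨a, ha⟩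
  exact ⟨k, by simpa using (congrArg Subtype.val hk).symm⟩

lemma neg_mem_isRoot {α : Module.Dual ℂ H} (h : α ≠ 0 ∧ ∃ x : L, x ≠ 0 ∧ IsRootVector H α x) :
    -α ≠ 0 ∧ ∃ x : L, x ≠ 0 ∧ IsRootVector H (-α) x := by
  obtain ⟨χ, hχ, rfl⟩ := isRoot_iff.1 h
  refine isRoot_iff.2 ⟨-χ, hχ.neg, ?_⟩
  ext y
  simp

/-- Root vectors forming `sl₂`-triples, suitably normalised, are dual families. -/
lemma isDualRootFamily_of_lie_eq_coroot (c : ℂ) {B : LinearMap.BilinForm ℂ L}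
    (hB : B = c • killingForm ℂ L) {R : Set (Module.Dual ℂ H)}
    (hR : R = {α | α ≠ 0 ∧ ∃ x : L, x ≠ 0 ∧ IsRootVector H α x})
    {t : Module.Dual ℂ H → H} (ht : ∀ α ∈ R, ∀ x : H, B (t α) x = α x)
    {e f : Module.Dual ℂ H → L} {hcoroot : Module.Dual ℂ H → H}
    (he : ∀ α ∈ R, IsRootVector H α (e α) ∧ e α ≠ 0)
    (hf : ∀ α ∈ R, IsRootVector H (-α) (f α) ∧ f α ≠ 0)
    (hef : ∀ α ∈ R, ⁅e α, f α⁆ = (hcoroot α : L)) (hcoroot2 : ∀ α ∈ R, α (hcoroot α) = 2)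
    (P : Submodule ℂ (Module.Dual ℂ H)) {S : Finset (Module.Dual ℂ H)}
    (hS : ∀ α, α ∈ S ↔ α ∈ R ∧ α ∈ P) :
    IsDualRootFamily_s1 (fun α : Module.Dual ℂ H ↦ (rootSpace H α).toSubmodule) B S e
      (fun α ↦ (B (t α) (t α) / 2) • f α) := by
  have hlie (a b d : L) : B ⁅a, b⁆ d = B a ⁅b, d⁆ := by
    simp [hB, killingForm, traceForm_apply_lie_apply]
  have hsymm (a b : L) : B a b = B b a := by
    simp [hB, killingForm, traceForm_comm ℂ L L a b]
  have hone {α} (hα : α ∈ R) : B (e α) ((B (t α) (t α) / 2) • f α) = 1 := by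
    have h₁ : B ⁅e α, f α⁆ (t α) = 2 := by rw [hef α hα, hsymm, ht α hα, hcoroot2 α hα]
    have h₂ : ⁅f α, (t α : L)⁆ = B (t α) (t α) • f α := by
      rw [← lie_skew, (hf α hα).1, ht α hα, LinearMap.neg_apply, neg_smul, neg_neg]
    rw [hlie, h₂, map_smul, smul_eq_mul] at h₁
    rw [map_smul, smul_eq_mul]
    linear_combination h₁ / 2
  have hR0 {α} (hα : α ∈ R) : α ≠ 0 := (hR ▸ hα : α ∈ {α | _}).1
  have hRneg {α} (hα : α ∈ R) : -α ∈ R := by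
    rw [hR] at hα ⊢
    exact neg_mem_isRoot hα
  constructor
  · intro α β a b ha hb
    exact lie_mem_genWeightSpace_of_mem_genWeightSpace ha hb
  · exact hlie
  · exact hsymm
  · intro β hβ
    exact isRootVector_iff.1 (he β ((hS β).1 hβ).1).1
  · intro β hβ
    exact Submodule.smul_mem _ _ (isRootVector_iff.1 (hf β ((hS β).1 hβ).1).1)
  · intro β hβ
    exact hone ((hS β).1 hβ).1
  · intro β hβ a ha
    have hβR := ((hS β).1 hβ).1
    obtain ⟨k, rfl⟩ := IsRootVector.exists_eq_smul (hR0 hβR) (he β hβR).2 (he β hβR).1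
      (isRootVector_iff.2 ha)
    have h₁ : B (k • e β) ((B (t β) (t β) / 2) • f β) = k := by
      rw [map_smul B k, LinearMap.smul_apply, hone hβR, smul_eq_mul, mul_one]
    rw [h₁]
  · intro α β hα hβ hαβ h₀
    rw [hS] at hα hβ hαβ
    refine (Submodule.eq_bot_iff _).2 fun x hx ↦ ?_
    by_contra hx₀
    refine hαβ ⟨?_, P.add_mem hα.2 hβ.2⟩
    rw [hR]
    exact ⟨h₀, x, hx₀, isRootVector_iff.2 hx⟩
  · intro α hα
    rw [hS] at hα ⊢
    exact ⟨hRneg hα.1, P.neg_mem hα.2⟩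
  · exact fun h ↦ hR0 ((hS 0).1 h).1 rfl

lemma exists_isRoot_add (hsl2 : ∃ J : LieIdeal ℂ L, LieAlgebra.IsSimple ℂ J ∧
      IsEmpty (J ≃ₗ⁅ℂ⁆ (LieAlgebra.SpecialLinear.sl (Fin 2) ℂ)))
    {R : Set (Module.Dual ℂ H)}
    (hR : R = {α | α ≠ 0 ∧ ∃ x : L, x ≠ 0 ∧ IsRootVector H α x}) :
    ∃ α ∈ R, ∃ β ∈ R, α + β ∈ R ∧ ∀ k : ℂ, β ≠ k • α := by
  obtain ⟨J, _, hJ⟩ := hsl2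
  obtain ⟨α, β, γ, hα, hβ, hγ, hadd, hne⟩ :=
    exists_weight_add_of_isEmpty_lieEquiv_sl (H := H) J hJ
  simp only [hR, Set.mem_ofPred_eq, isRoot_iff]
  exact ⟨_, ⟨α, hα, rfl⟩, _, ⟨β, hβ, rfl⟩, ⟨γ, hγ, hadd⟩, hne⟩

end RootVectors

section PositiveRoots

variable {V : Type*} [AddCommGroup V] {R Rp : Set V}

lemma exists_pos_mem_iff {K : Type*} [Field K] [Module K V] (hRp : ∀ α ∈ R, α ∈ Rp ∨ -α ∈ Rp)
    {α : V} (hα : α ∈ R) : ∃ b : Rp, ∀ P : Submodule K V, (b : V) ∈ P ↔ α ∈ P := by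
  rcases hRp α hα with h | h
  · exact ⟨⟨α, h⟩, fun P ↦ Iff.rfl⟩
  · exact ⟨⟨-α, h⟩, fun P ↦ P.neg_mem_iff⟩

/-- A sum over a symmetric set of roots is a sum over its positive roots. -/
lemma sum_eq_sum_pos_add_neg {M : Type*} [AddCommMonoid M] {S : Finset V} {T : Finset Rp}
    (hRp1 : ∀ α ∈ S, α ∈ Rp ∨ -α ∈ Rp) (hRp2 : ∀ α ∈ Rp, -α ∉ Rp)
    (hS : ∀ α ∈ S, -α ∈ S) (hT : ∀ b : Rp, b ∈ T ↔ (b : V) ∈ S) (u : V → M) :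
    ∑ β ∈ S, u β = ∑ b ∈ T, (u b + u (-b)) := by
  classical
  have h₁ : S.filter (· ∈ Rp) = T.map (Function.Embedding.subtype _) := by
    ext α
    simp only [Finset.mem_filter, Finset.mem_map, Function.Embedding.subtype_apply]
    exact ⟨fun h ↦ ⟨⟨α, h.2⟩, (hT _).2 h.1, rfl⟩, fun ⟨b, hb, h⟩ ↦ h ▸ ⟨(hT b).1 hb, b.2⟩⟩
  have h₂ : ∑ β ∈ S with β ∉ Rp, u β = ∑ β ∈ S with β ∈ Rp, u (-β) := by
    refine Finset.sum_nbij' (-·) (-·) ?_ ?_ (fun _ _ ↦ neg_neg _) (fun _ _ ↦ neg_neg _)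
      (fun _ _ ↦ by rw [neg_neg])
    · intro α hα
      rw [Finset.mem_filter] at hα ⊢
      exact ⟨hS α hα.1, (hRp1 α hα.1).resolve_left hα.2⟩
    · intro α hα
      rw [Finset.mem_filter] at hα ⊢
      exact ⟨hS α hα.1, hRp2 α hα.2⟩
  rw [← Finset.sum_filter_add_sum_filter_not S (· ∈ Rp), h₂, ← Finset.sum_add_distrib, h₁,
    Finset.sum_map]
  rfl

end PositiveRoots

/-- the homomorphism from the free algebra on generators `r_α`, `α ∈ R⁺`, to `U(g)`
sending `r_α` to the truncated Casimir `κ_α` kills the defining (two-sided) ideal of relations of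
the holonomy Lie algebra of the root arrangement, but its kernel is strictly bigger whenever some
simple ideal of `g` is not isomorphic to `sl₂(ℂ)`. -/
theorem holonomy_to_enveloping_not_injective
    {L : Type} [LieRing L] [LieAlgebra ℂ L] [FiniteDimensional ℂ L]
    [LieAlgebra.IsSemisimple ℂ L]
    (H : LieSubalgebra ℂ L) [H.IsCartanSubalgebra]
    (c : ℂ) (hc : c ≠ 0)
    (B : LinearMap.BilinForm ℂ L) (hB : B = c • killingForm ℂ L)
    (R : Set (Module.Dual ℂ H))
    (hR : R = {α | α ≠ 0 ∧ ∃ x : L, x ≠ 0 ∧ IsRootVector H α x})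
    -- a system of positive roots
    (Rp : Set (Module.Dual ℂ H)) (hRpR : Rp ⊆ R)
    (hRp1 : ∀ α ∈ R, α ∈ Rp ∨ -α ∈ Rp) (hRp2 : ∀ α ∈ Rp, -α ∉ Rp)
    (hRp3 : ∀ α ∈ Rp, ∀ β ∈ Rp, α + β ∈ R → α + β ∈ Rp)
    (t : Module.Dual ℂ H → H)
    (ht : ∀ α ∈ R, ∀ x : H, B (t α) x = α x)
    (e f : Module.Dual ℂ H → L) (hcoroot : Module.Dual ℂ H → H)
    (he : ∀ α ∈ R, IsRootVector H α (e α) ∧ e α ≠ 0)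
    (hf : ∀ α ∈ R, IsRootVector H (-α) (f α) ∧ f α ≠ 0)
    (hef : ∀ α ∈ R, ⁅e α, f α⁆ = (hcoroot α : L))
    (hcoroot2 : ∀ α ∈ R, α (hcoroot α) = 2)
    (κ : Module.Dual ℂ H → UniversalEnvelopingAlgebra ℂ L)
    (hκ : ∀ α ∈ R, κ α = (B (t α) (t α) / 2) •
      (ι ℂ (e α) * ι ℂ (f α) + ι ℂ (f α) * ι ℂ (e α)))
    -- the homomorphism from the free algebra on `{r_α}_{α ∈ R⁺}` to `U(g)`
    (Φ : FreeAlgebra ℂ Rp →ₐ[ℂ] UniversalEnvelopingAlgebra ℂ L)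
    (hΦ : ∀ a : Rp, Φ (FreeAlgebra.ι ℂ a) = κ (a : Module.Dual ℂ H))
    -- the two-sided ideal of holonomy relations
    (I : TwoSidedIdeal (FreeAlgebra ℂ Rp))
    (hI : I = TwoSidedIdeal.span
      {x | ∃ (P : Submodule ℂ (Module.Dual ℂ H)) (α : Rp),
        (∃ β ∈ R, ∃ γ ∈ R, P = Submodule.span ℂ {β, γ}) ∧
        Module.finrank ℂ P = 2 ∧ (α : Module.Dual ℂ H) ∈ P ∧
        x = FreeAlgebra.ι ℂ α *
              (∑ᶠ β ∈ {b : Rp | (b : Module.Dual ℂ H) ∈ P}, FreeAlgebra.ι ℂ β) -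
            (∑ᶠ β ∈ {b : Rp | (b : Module.Dual ℂ H) ∈ P}, FreeAlgebra.ι ℂ β) *
              FreeAlgebra.ι ℂ α})
    -- some simple ideal of `g` is not isomorphic to `sl₂(ℂ)`
    (hsl2 : ∃ J : LieIdeal ℂ L, LieAlgebra.IsSimple ℂ J ∧
      IsEmpty (J ≃ₗ⁅ℂ⁆ (LieAlgebra.SpecialLinear.sl (Fin 2) ℂ))) :
    (∀ x ∈ I, Φ x = 0) ∧ ∃ x, Φ x = 0 ∧ x ∉ I := by
  classical
  have hRfin : R.Finite := hR ▸ finite_isRoot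
  have : Finite Rp := hRfin.subset hRpR
  refine ⟨?_, ?_⟩
  · suffices I ≤ TwoSidedIdeal.ker Φ from fun x hx ↦ (TwoSidedIdeal.mem_ker _).1 (this hx)
    rw [hI, TwoSidedIdeal.span_le]
    rintro _ ⟨P, α, -, -, hα, rfl⟩
    have hS (β) : β ∈ (hRfin.inter_of_left (P : Set (Module.Dual ℂ H))).toFinset ↔
        β ∈ R ∧ β ∈ P := by simp
    set S := (hRfin.inter_of_left (P : Set (Module.Dual ℂ H))).toFinset
    have hD := isDualRootFamily_of_lie_eq_coroot c hB hR ht he hf hef hcoroot2 P hS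
    have hκ' {β} (hβ : β ∈ R) : κ β = ι ℂ (e β) * ι ℂ ((B (t β) (t β) / 2) • f β) +
        ι ℂ ((B (t β) (t β) / 2) • f β) * ι ℂ (e β) := by
      rw [hκ β hβ, map_smul, mul_smul_comm, smul_mul_assoc, smul_add]
    have hsum : Φ (∑ᶠ β ∈ {b : Rp | (b : Module.Dual ℂ H) ∈ P}, FreeAlgebra.ι ℂ β) =
        ∑ β ∈ S, ι ℂ (e β) * ι ℂ ((B (t β) (t β) / 2) • f β) := by
      rw [finsum_mem_eq_finite_toFinset_sum _ (Set.toFinite _), map_sum,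
        sum_eq_sum_pos_add_neg (fun α hα ↦ hRp1 α ((hS α).1 hα).1) hRp2 (fun _ ↦ hD.neg_mem)
          (fun b ↦ by rw [hS, Set.Finite.mem_toFinset]; exact (and_iff_right (hRpR b.2)).symm)]
      refine Finset.sum_congr rfl fun b hb ↦ ?_
      have hb' := (Set.Finite.mem_toFinset _).1 hb
      rw [hΦ, hκ' (hRpR b.2), hD.ι_neg_mul_ι_neg ((hS b).2 ⟨hRpR b.2, hb'⟩)]
    refine (TwoSidedIdeal.mem_ker _).2 ?_
    rw [map_sub, map_mul, map_mul, hsum, hΦ, hκ' (hRpR α.2), sub_eq_zero]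
    exact hD.commute_truncatedCasimir_sum ((hS α).2 ⟨hRpR α.2, hα⟩)
  · obtain ⟨α, hα, β, hβ, hαβ, hne⟩ := exists_isRoot_add hsl2 hR
    have hspan : β ∉ Submodule.span ℂ {α} := fun h ↦ by
      obtain ⟨k, hk⟩ := Submodule.mem_span_singleton.1 h
      exact hne k hk.symm
    have hspan' : α ∉ Submodule.span ℂ {β} := fun h ↦ by
      obtain ⟨k, hk⟩ := Submodule.mem_span_singleton.1 h
      have hk₀ : k ≠ 0 := by
        rintro rfl
        rw [hR] at hα
        exact hα.1 (by rw [← hk, zero_smul])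
      exact hne k⁻¹ (by rw [← hk, inv_smul_smul₀ hk₀])
    obtain ⟨b₁, h₁⟩ := exists_pos_mem_iff (K := ℂ) hRp1 hα
    obtain ⟨b₂, h₂⟩ := exists_pos_mem_iff (K := ℂ) hRp1 hβ
    obtain ⟨b₃, h₃⟩ := exists_pos_mem_iff (K := ℂ) hRp1 hαβ
    have hmem := Submodule.mem_span_singleton_self (R := ℂ) α
    have hmem' := Submodule.mem_span_singleton_self (R := ℂ) β
    obtain ⟨π, hπ₁, hπ₂, hπ⟩ := exists_algHom_freeAlgebra_bool (K := ℂ) (b₁ := b₁) (b₂ := b₂)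
      (b₃ := b₃) (fun h ↦ hspan ((h₂ _).1 (h ▸ (h₁ _).2 hmem)))
      (fun h ↦ hspan ((Submodule.add_mem_iff_right _ hmem).1 ((h₃ _).1 (h ▸ (h₁ _).2 hmem))))
      (fun h ↦ hspan' ((Submodule.add_mem_iff_left _ hmem').1 ((h₃ _).1 (h ▸ (h₂ _).2 hmem'))))
    have hIπ : I ≤ TwoSidedIdeal.ker π := by
      rw [hI, TwoSidedIdeal.span_le]
      rintro _ ⟨P, a, -, -, ha, rfl⟩
      refine (TwoSidedIdeal.mem_ker _).2 ?_
      rw [map_sub, map_mul, map_mul, sub_eq_zero]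
      refine hπ _ ?_ ?_ ?_ a ha <;> simp only [Set.mem_ofPred_eq, h₁, h₂, h₃]
      · exact P.add_mem
      · exact fun h ↦ (P.add_mem_iff_right h).1
      · exact fun h ↦ (P.add_mem_iff_left h).1
    let θ : FreeAlgebra ℂ Bool →ₐ[ℂ] FreeAlgebra ℂ Rp :=
      FreeAlgebra.lift ℂ fun i ↦ FreeAlgebra.ι ℂ (if i then b₁ else b₂)
    have hπθ : π.comp θ = AlgHom.id ℂ _ := by
      ext i
      cases i <;> simp [θ, hπ₁, hπ₂]
    let b := Module.Free.chooseBasis ℂ L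
    have hκb (a : Rp) : κ a ∈ envelopingFiltration b 2 := by
      rw [hκ a (hRpR a.2)]
      have (x y : L) := mul_mem_envelopingFiltration b (ι_mem_envelopingFiltration b x)
        (ι_mem_envelopingFiltration b y)
      exact Submodule.smul_mem _ _ (Submodule.add_mem _ (this _ _) (this _ _))
    have hinj := not_injective_freeAlgebra_enveloping b 2 (Φ.comp θ)
      (fun i ↦ by simpa [θ, hΦ] using hκb _)
    rw [injective_iff_map_eq_zero] at hinj
    push Not at hinj
    obtain ⟨p, hp, hp₀⟩ := hinj
    refine ⟨θ p, hp, fun h ↦ hp₀ ?_⟩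
    rw [← (TwoSidedIdeal.mem_ker _).1 (hIπ h)]
    exact (AlgHom.congr_fun hπθ p).symm
end

section
/- For all positive integers n, r and every integer p with 0 < p < n, there exists a finite set S of polynomials with complex coefficients in the r·n² matrix entries such that an r-tuple (A₁,…,A_r) of n×n complex matrices possesses a common invariant linear subspace of dimension p if and only if every polynomial in S vanishes at (A₁,…,A_r). In particular, for a group Γ generated by r elements, the set of reducible representations Γ → GL_n(ℂ) is Zariski-closed in Hom(Γ, GL_n(ℂ)). -/
namespace MvPolynomial

variable {σ τ R k : Type*}

/-- A homogeneous polynomial all of whose coefficients lie in an ideal `J` of the coefficient ring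
belongs to `J` times the module of homogeneous polynomials of that degree. -/
lemma IsHomogeneous.mem_smul_homogeneousSubmodule [CommRing R] {J : Ideal R} {d : ℕ}
    {p : MvPolynomial τ R} (hp : p.IsHomogeneous d) (hJ : ∀ s, p.coeff s ∈ J) :
    p ∈ J • homogeneousSubmodule τ R d := by
  rw [p.as_sum]
  refine Submodule.sum_mem _ fun s hs => ?_
  have hs' : monomial s (p.coeff s) = p.coeff s • monomial s (1 : R) := by
    simp [smul_monomial]
  rw [hs']
  refine Submodule.smul_mem_smul (hJ s) ?_
  refine isHomogeneous_monomial _ ?_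
  by_contra hd
  exact mem_support_iff.1 hs (hp.coeff_eq_zero hd)

/-- If the only common zero of an ideal of polynomials over an algebraically closed field is the
origin, then the ideal contains all homogeneous polynomials of some degree. -/
lemma exists_homogeneousSubmodule_le_of_zeroLocus_subset [Finite τ] [Field k] [IsAlgClosed k]
    {I : Ideal (MvPolynomial τ k)} (hI : zeroLocus k I ⊆ {0}) :
    ∃ d : ℕ, ∀ p : MvPolynomial τ k, p.IsHomogeneous d → p ∈ I := by
  have hle : idealOfVars τ k ≤ I.radical := by
    rw [← vanishingIdeal_zeroLocus_eq_radical (K := k), idealOfVars, Ideal.span_le]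
    rintro _ ⟨i, rfl⟩ x hx
    have hx0 : x = 0 := hI hx
    simp [hx0]
  obtain ⟨d, hd⟩ := Ideal.exists_pow_le_of_le_radical_of_fg hle (idealOfVars_fg τ k)
  refine ⟨d, fun p hp => hd ?_⟩
  rw [mem_pow_idealOfVars_iff']
  intro s hs
  exact hp.coeff_eq_zero (by omega)

/-- An ideal generated by homogeneous polynomials contains the homogeneous components of its
elements. -/
lemma homogeneousComponent_mem_span [CommRing R] {T : Set (MvPolynomial τ R)}
    (hT : ∀ f ∈ T, ∃ d, f.IsHomogeneous d) (d : ℕ) {f : MvPolynomial τ R}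
    (hf : f ∈ Ideal.span T) : homogeneousComponent d f ∈ Ideal.span T := by
  let : GradedAlgebra (homogeneousSubmodule τ R) := gradedAlgebra
  have h := Ideal.homogeneous_span (homogeneousSubmodule τ R) T hT d hf
  rwa [← decomposition.decompose'_apply]

/-- **Main theorem of elimination theory**: the locus of parameters for which a homogeneous system
of polynomial equations has a nontrivial solution is Zariski closed. -/
theorem exists_finset_forall_exists_ne_zero_iff [Finite σ] [Finite τ] [Field k] [IsAlgClosed k]
    (I : Ideal (MvPolynomial τ (MvPolynomial σ k)))
    (hI : ∀ d : ℕ, ∀ f ∈ I, homogeneousComponent d f ∈ I) :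
    ∃ S : Finset (MvPolynomial σ k), ∀ a : σ → k,
      (∃ w : τ → k, w ≠ 0 ∧ ∀ f ∈ I, eval w (map (eval a) f) = 0) ↔ ∀ P ∈ S, eval a P = 0 := by
  obtain ⟨S, hS⟩ := (isNoetherianRing_iff_ideal_fg (MvPolynomial σ k)).1 inferInstance
    (Ideal.span {b | ∃ d : ℕ, ∀ p ∈ homogeneousSubmodule τ (MvPolynomial σ k) d, b • p ∈ I})
  have hzero (T : Set (MvPolynomial σ k)) (a : σ → k) :
      (∀ P ∈ T, eval a P = 0) ↔ Ideal.span T ≤ RingHom.ker (eval a) := by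
    simp [Ideal.span_le, Set.subset_def]
  refine ⟨S, fun a => ?_⟩
  have hS' : (∀ P ∈ S, eval a P = 0) ↔ _ := hzero (S : Set (MvPolynomial σ k)) a
  rw [hS', hS, ← hzero]
  constructor
  · rintro ⟨w, hw, hwI⟩ b ⟨d, hd⟩
    obtain ⟨i, hi⟩ := Function.ne_iff.1 hw
    have h := hwI _ (hd (X i ^ d) (isHomogeneous_X_pow i d))
    simpa [smul_eq_C_mul, show w i ≠ 0 from hi] using h
  · intro h
    by_contra! hno
    have hsurj : Function.Surjective (map (σ := τ) (eval a)) :=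
      map_surjective _ fun c => ⟨C c, eval_C c⟩
    obtain ⟨d, hd⟩ := exists_homogeneousSubmodule_le_of_zeroLocus_subset
      (I := I.map (map (eval a))) (by
        intro w hw
        by_contra hw0
        obtain ⟨f, hf, hne⟩ := hno w hw0
        exact hne (by simpa [aeval_eq_eval] using hw _ (Ideal.mem_map_of_mem _ hf)))
    obtain ⟨b, hb, hbI⟩ := Submodule.exists_sub_one_mem_and_smul_le_of_fg_of_le_sup
      (I := RingHom.ker (eval a)) (N := I.restrictScalars (MvPolynomial σ k))
      (homogeneousSubmodule_fg (σ := τ) (R := MvPolynomial σ k) d) le_rfl (by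
        intro p hp
        obtain ⟨f, hf, hfp⟩ := (Ideal.mem_map_iff_of_surjective _ hsurj).1
          (hd _ (IsHomogeneous.map hp (eval a)))
        rw [← add_sub_cancel (homogeneousComponent d f) p]
        refine Submodule.add_mem_sup (hI d f hf)
          (IsHomogeneous.mem_smul_homogeneousSubmodule
            (hp.sub (homogeneousComponent_isHomogeneous d f)) fun s => ?_)
        rw [RingHom.mem_ker, coeff_sub, map_sub, sub_eq_zero, coeff_homogeneousComponent]
        split_ifs with hs
        · rw [← coeff_map, ← coeff_map, hfp]
        · rw [IsHomogeneous.coeff_eq_zero hp hs])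
    have hb0 : eval a b = 0 :=
      h b ⟨d, fun p hp => hbI (Submodule.smul_mem_pointwise_smul p b _ hp)⟩
    simp [RingHom.mem_ker, hb0] at hb

end MvPolynomial

namespace Matrix

variable {m ι K : Type*} [Fintype ι] [DecidableEq ι]

/-- Replacing a row of a maximal submatrix by another row of the ambient matrix computes the
product with the adjugate. -/
lemma det_submatrix_update [CommRing K] (M : Matrix m ι K) (s : ι → m) (j : ι) (a : m) :
    (M.submatrix (Function.update s j a) id).det = (M * (M.submatrix s id).adjugate) a j := by
  have h : M.submatrix (Function.update s j a) id = (M.submatrix s id).updateRow j (M a) := by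
    ext i l
    by_cases hij : i = j
    · subst hij; simp
    · simp [hij]
  rw [h, ← cramer_transpose_apply, cramer_eq_adjugate_mulVec, ← adjugate_transpose,
    mulVec_transpose]
  rfl

variable [Fintype m]

/-- Equations, homogeneous in `w`, expressing that for every index `s` with `w s ≠ 0` the columns
`a ↦ w (Function.update s j a)` are linearly independent and span an `A`-invariant subspace. -/
def IsInvariantCoordinates {r : Type*} [CommRing K] (A : r → Matrix m m K)
    (w : (ι → m) → K) : Prop :=
  (∀ (s : ι → m) (j l : ι), l ≠ j → w (Function.update s j (s l)) = 0) ∧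
    ∀ (i : r) (s : ι → m) (a : m) (j : ι),
      w s * ∑ b, A i a b * w (Function.update s j b) =
        ∑ l, w (Function.update s l a) * ∑ b, A i (s l) b * w (Function.update s j b)

/-- The maximal minors of a matrix whose column space is invariant under each `A i` satisfy the
invariance equations. -/
lemma isInvariantCoordinates_minors {r : Type*} [CommRing K] {A : r → Matrix m m K}
    {M : Matrix m ι K} (h : ∀ i, ∃ Y : Matrix ι ι K, A i * M = M * Y) :
    IsInvariantCoordinates A fun s : ι → m => (M.submatrix s id).det := by
  refine ⟨fun s j l hlj => ?_, fun i s a j => ?_⟩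
  · refine det_zero_of_row_eq hlj (funext fun c => ?_)
    simp [hlj]
  · obtain ⟨Y, hY⟩ := h i
    set N := M.submatrix s id with hN
    have hsum (c : m) : ∑ b, A i c b * (M.submatrix (Function.update s j b) id).det =
        (M * (Y * N.adjugate)) c j := by
      simp_rw [det_submatrix_update, ← mul_apply]
      rw [← Matrix.mul_assoc, hY, Matrix.mul_assoc]
    have hrow (l : ι) : (M * (Y * N.adjugate)) (s l) j = (N * (Y * N.adjugate)) l j := rfl
    simp_rw [hsum, hrow, det_submatrix_update, ← hN]
    rw [← mul_apply, Matrix.mul_assoc, ← Matrix.mul_assoc N.adjugate, adjugate_mul, smul_mul,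
      Matrix.one_mul, Matrix.mul_smul, Matrix.smul_apply, smul_eq_mul]

variable [DecidableEq m]

/-- A rectangular matrix with linearly independent columns has a nonzero maximal minor. -/
lemma exists_det_submatrix_ne_zero [Field K] {M : Matrix m ι K}
    (hM : Function.Injective M.mulVec) : ∃ s : ι → m, (M.submatrix s id).det ≠ 0 := by
  by_contra! h
  obtain ⟨g, hg⟩ := LinearMap.exists_leftInverse_of_injective (toLin' M)
    (LinearMap.ker_eq_bot.2 hM)
  have hL : LinearMap.toMatrix' g * M = 1 := by
    rw [← LinearMap.toMatrix'_toLin' M, ← LinearMap.toMatrix'_comp, hg, LinearMap.toMatrix'_id]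
  have hdet : (LinearMap.toMatrix' g * M).det = 0 := by
    have hrow : LinearMap.toMatrix' g * M = fun i => ∑ a, LinearMap.toMatrix' g i a • M a := by
      ext i j
      simp [mul_apply]
    rw [hrow]
    change detRowAlternating.toMultilinearMap _ = 0
    rw [MultilinearMap.map_sum]
    refine Finset.sum_eq_zero fun s _ => ?_
    rw [MultilinearMap.map_smul_univ]
    have : detRowAlternating.toMultilinearMap (fun i => M (s i)) = 0 := h s
    rw [this, smul_zero]
  rw [hL, det_one] at hdet
  exact one_ne_zero hdet

/-- Matrices have a common invariant subspace of dimension `Fintype.card ι` exactly when the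
homogeneous invariance equations have a nonzero solution. -/
theorem exists_invariant_submodule_iff {r : Type*} [Field K] (A : r → Matrix m m K) :
    (∃ U : Submodule K (m → K), Module.finrank K U = Fintype.card ι ∧
        ∀ i, ∀ v ∈ U, A i *ᵥ v ∈ U) ↔
      ∃ w : (ι → m) → K, w ≠ 0 ∧ IsInvariantCoordinates A w := by
  constructor
  · rintro ⟨U, hU, hA⟩
    let e : Module.Basis ι K U := (Module.finBasisOfFinrankEq K U hU).reindex
      (Fintype.equivFin ι).symm
    let M : Matrix m ι K := of fun a j => (e j : m → K) a
    have hMv (x : ι → K) : M *ᵥ x = ((e.equivFun.symm x : U) : m → K) := by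
      ext a
      simp [M, mulVec, dotProduct, e.equivFun_symm_apply, mul_comm]
    have hinj : Function.Injective M.mulVec := fun x y hxy => by
      rw [hMv, hMv] at hxy
      exact e.equivFun.symm.injective (Subtype.ext hxy)
    obtain ⟨s, hs⟩ := exists_det_submatrix_ne_zero hinj
    refine ⟨fun s => (M.submatrix s id).det, fun h => hs (congrFun h s),
      isInvariantCoordinates_minors fun i =>
        ⟨of fun l j => e.equivFun ⟨A i *ᵥ e j, hA i _ (e j).2⟩ l, ?_⟩⟩
    ext a j
    have h := congrFun (hMv (e.equivFun ⟨A i *ᵥ e j, hA i _ (e j).2⟩)) a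
    rw [LinearEquiv.symm_apply_apply] at h
    exact h.symm
  · rintro ⟨w, hw, hwalt, hwinv⟩
    obtain ⟨s, hs⟩ := Function.ne_iff.1 hw
    replace hs : w s ≠ 0 := hs
    let M : Matrix m ι K := of fun a j => w (Function.update s j a)
    have hMs : M.submatrix s id = w s • (1 : Matrix ι ι K) := by
      ext l j
      by_cases hlj : l = j
      · subst hlj; simp [M]
      · simp [M, hlj, hwalt s j l hlj]
    have hinj : Function.Injective M.mulVecLin := fun x y hxy => by
      have h (z : ι → K) : (fun l => (M *ᵥ z) (s l)) = w s • z := by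
        change M.submatrix s id *ᵥ z = _
        rw [hMs, smul_mulVec, one_mulVec]
      have hxy' : M *ᵥ x = M *ᵥ y := hxy
      refine smul_right_injective _ hs ?_
      change w s • x = w s • y
      rw [← h, ← h, hxy']
    refine ⟨LinearMap.range M.mulVecLin, ?_, ?_⟩
    · rw [LinearMap.finrank_range_of_inj hinj, Module.finrank_fintype_fun_eq_card]
    · rintro i _ ⟨x, rfl⟩
      have hY : w s • (A i * M) = M * (A i * M).submatrix s id := by
        ext a j
        exact hwinv i s a j
      refine ⟨(w s)⁻¹ • ((A i * M).submatrix s id *ᵥ x), ?_⟩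
      rw [mulVecLin_apply, mulVecLin_apply, mulVec_smul, mulVec_mulVec, ← hY, smul_mulVec,
        inv_smul_smul₀ hs, mulVec_mulVec]

end Matrix

namespace MvPolynomial

open Matrix

/-- The invariance equations for a tuple of matrices are the specialisation of a homogeneous ideal
over the polynomial ring in the matrix entries. -/
lemma exists_homogeneous_ideal_isInvariantCoordinates {m ι r k : Type*} [Fintype m]
    [Fintype ι] [DecidableEq ι] [CommRing k] :
    ∃ I : Ideal (MvPolynomial (ι → m) (MvPolynomial (r × m × m) k)),
      (∀ d : ℕ, ∀ f ∈ I, homogeneousComponent d f ∈ I) ∧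
      ∀ (A : r → Matrix m m k) (w : (ι → m) → k),
        (∀ f ∈ I, eval w (map (eval fun q : r × m × m => A q.1 q.2.1 q.2.2) f) = 0) ↔
          IsInvariantCoordinates A w := by
  let Y : (ι → m) → MvPolynomial (ι → m) (MvPolynomial (r × m × m) k) := X
  let Z (i : r) (a b : m) : MvPolynomial (ι → m) (MvPolynomial (r × m × m) k) := C (X (i, a, b))
  let F (q : (ι → m) × ι × ι) :=
    if q.2.2 = q.2.1 then 0 else Y (Function.update q.1 q.2.1 (q.1 q.2.2))
  let G (q : r × (ι → m) × m × ι) :=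
    Y q.2.1 * ∑ b, Z q.1 q.2.2.1 b * Y (Function.update q.2.1 q.2.2.2 b) -
      ∑ l, Y (Function.update q.2.1 l q.2.2.1) *
        ∑ b, Z q.1 (q.2.1 l) b * Y (Function.update q.2.1 q.2.2.2 b)
  have hlin (i : r) (a : m) (s : ι → m) (j : ι) :
      (∑ b, Z i a b * Y (Function.update s j b)).IsHomogeneous 1 :=
    IsHomogeneous.sum _ _ _ fun b _ => by
      simpa using (isHomogeneous_C _ (X (i, a, b))).mul (isHomogeneous_X _ (Function.update s j b))
  refine ⟨Ideal.span (Set.range F ∪ Set.range G), fun d f hf =>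
    homogeneousComponent_mem_span ?_ d hf, fun A w => ?_⟩
  · rintro _ (⟨q, rfl⟩ | ⟨q, rfl⟩)
    · refine ⟨1, ?_⟩
      dsimp only [F]
      split_ifs
      · exact isHomogeneous_zero _ _ _
      · exact isHomogeneous_X _ _
    · exact ⟨1 + 1, ((isHomogeneous_X _ _).mul (hlin _ _ _ _)).sub
        (IsHomogeneous.sum _ _ _ fun l _ => (isHomogeneous_X _ _).mul (hlin _ _ _ _))⟩
  · let φ := (eval w).comp (map (eval fun q : r × m × m => A q.1 q.2.1 q.2.2))
    have hφ : (∀ f ∈ Ideal.span (Set.range F ∪ Set.range G), φ f = 0) ↔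
        Ideal.span (Set.range F ∪ Set.range G) ≤ RingHom.ker φ := Iff.rfl
    refine hφ.trans ?_
    have hY (s : ι → m) : φ (Y s) = w s := by simp [φ, Y]
    have hZ (i : r) (a b : m) : φ (Z i a b) = A i a b := by simp [φ, Z]
    rw [Ideal.span_le, Set.union_subset_iff, Set.range_subset_iff, Set.range_subset_iff]
    refine and_congr ⟨fun h s j l hlj => ?_, fun h q => ?_⟩ ⟨fun h i s a j => ?_, fun h q => ?_⟩
    · have := h (s, j, l)
      simpa [F, hlj, RingHom.mem_ker, hY] using this
    · by_cases hq : q.2.2 = q.2.1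
      · simp [F, hq]
      · simpa [F, hq, RingHom.mem_ker, hY] using h q.1 q.2.1 q.2.2 hq
    · have := h (i, s, a, j)
      simpa [G, RingHom.mem_ker, hY, hZ, sub_eq_zero] using this
    · simpa [G, RingHom.mem_ker, hY, hZ, sub_eq_zero] using h q.1 q.2.1 q.2.2.1 q.2.2.2

end MvPolynomial


/-- for fixed `n, r, p` with `0 < p < n`, the existence of a common invariant
subspace of dimension `p` for an `r`-tuple of `n × n` complex matrices is cut out by the
vanishing of a finite set of polynomials in the `r·n²` matrix entries.  In particular, the set
of reducible representations of an `r`-generated group is Zariski closed. -/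
theorem reducible_tuples_zariski_closed (n r p : ℕ) (hn : 0 < n) (hr : 0 < r)
    (hp : 0 < p) (hpn : p < n) :
    ∃ S : Finset (MvPolynomial (Fin r × Fin n × Fin n) ℂ),
      ∀ A : Fin r → Matrix (Fin n) (Fin n) ℂ,
        (∃ U : Submodule ℂ (Fin n → ℂ), Module.finrank ℂ U = p ∧
            ∀ i : Fin r, ∀ v ∈ U, (A i).mulVec v ∈ U) ↔
          ∀ P ∈ S, MvPolynomial.eval (fun q : Fin r × Fin n × Fin n => A q.1 q.2.1 q.2.2) P = 0 := by
  obtain ⟨I, hI, hIA⟩ :=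
    MvPolynomial.exists_homogeneous_ideal_isInvariantCoordinates
      (m := Fin n) (ι := Fin p) (r := Fin r) (k := ℂ)
  obtain ⟨S, hS⟩ := MvPolynomial.exists_finset_forall_exists_ne_zero_iff I hI
  refine ⟨S, fun A => ?_⟩
  rw [← hS]
  simp_rw [hIA]
  simpa using Matrix.exists_invariant_submodule_iff (ι := Fin p) A
end

section
/- Let r, n be positive integers and for i = 1,…,r let ρ_i : ℂ → GL_n(ℂ) be maps all of whose matrix entries are entire (complex-analytic) functions. Call h ∈ ℂ reducible if the matrices ρ₁(h),…,ρ_r(h) admit a common invariant linear subspace U ⊆ ℂⁿ with 0 ≠ U ≠ ℂⁿ. Then either every h ∈ ℂ is reducible, or the set of reducible h ∈ ℂ has no accumulation point in ℂ; in other words, an analytic curve of representations of a finitely generated group is either reducible for all parameter values or generically irreducible. -/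
/-- **Burnside's theorem** on matrix algebras: over an algebraically closed field, a subalgebra of
`End V` with no nontrivial invariant subspace is all of `End V`. -/
theorem Subalgebra.eq_top_of_forall_invariant {k V : Type*} [Field k] [IsAlgClosed k]
    [AddCommGroup V] [Module k V] [FiniteDimensional k V] [Nontrivial V]
    (A : Subalgebra k (Module.End k V))
    (hA : ∀ U : Submodule k V, (∀ a ∈ A, ∀ v ∈ U, a v ∈ U) → U = ⊥ ∨ U = ⊤) : A = ⊤ := by
  have hsimple : IsSimpleModule A V := by
    refine { eq_bot_or_eq_top := fun U => ?_ }
    rcases hA (U.restrictScalars k) fun a ha v hv => U.smul_mem ⟨a, ha⟩ hv with h | h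
    · left
      rwa [Submodule.restrictScalars_eq_bot_iff] at h
    · right
      rwa [Submodule.restrictScalars_eq_top_iff] at h
  have hschur := IsSimpleModule.algebraMap_end_bijective_of_isAlgClosed (A := A) (V := V) k
  rw [eq_top_iff]
  intro f _
  let g : Module.End (Module.End A V) V :=
    { toFun := f
      map_add' := map_add f
      map_smul' := fun e v => by
        obtain ⟨c, rfl⟩ := hschur.2 e
        simp }
  obtain ⟨s, hs⟩ := Module.Finite.fg_top (R := k) (M := V)
  obtain ⟨a, ha⟩ := jacobson_density (R := A) g s
  have : f = (a : Module.End k V) := LinearMap.ext_on hs fun v hv => ha v hv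
  exact this ▸ a.2

/-- The value of a word in the entries of a tuple of square matrices. -/
def Matrix.wordProd {ι m R : Type*} [Fintype m] [DecidableEq m] [Semiring R]
    (M : ι → Matrix m m R) (l : List ι) : Matrix m m R :=
  (l.map M).prod

namespace Matrix

variable {ι m k : Type*} [Fintype m] [DecidableEq m] [Field k]

theorem wordProd_mulVec_mem {M : ι → Matrix m m k} {U : Submodule k (m → k)}
    (hU : ∀ i, ∀ v ∈ U, (M i).mulVec v ∈ U) (l : List ι) :
    ∀ v ∈ U, (wordProd M l).mulVec v ∈ U := by
  induction l with
  | nil => simp [wordProd]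
  | cons i l ih =>
    intro v hv
    rw [wordProd, List.map_cons, List.prod_cons, ← mulVec_mulVec]
    exact hU i _ (ih v hv)

/-- If the words in a tuple of matrices span the full matrix algebra, then every common invariant
subspace is trivial. -/
theorem eq_bot_or_eq_top_of_span_wordProd {M : ι → Matrix m m k} {κ : Type*} {a : κ → List ι}
    (hM : Submodule.span k (Set.range fun p => wordProd M (a p)) = ⊤)
    {U : Submodule k (m → k)} (hU : ∀ i, ∀ v ∈ U, (M i).mulVec v ∈ U) : U = ⊥ ∨ U = ⊤ := by
  have hall (B : Matrix m m k) (v : m → k) (hv : v ∈ U) : B.mulVec v ∈ U := by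
    have hB : B ∈ Submodule.span k (Set.range fun p => wordProd M (a p)) := hM ▸ trivial
    induction hB using Submodule.span_induction with
    | mem B hB =>
      obtain ⟨p, rfl⟩ := hB
      exact wordProd_mulVec_mem hU _ v hv
    | zero => simp
    | add B C _ _ hB hC => rw [add_mulVec]; exact U.add_mem hB hC
    | smul c B _ hB => rw [smul_mulVec]; exact U.smul_mem c hB
  rw [or_iff_not_imp_left]
  intro hbot
  obtain ⟨v, hv, hv0⟩ := U.ne_bot_iff.1 hbot
  obtain ⟨j, hj⟩ := Function.ne_iff.1 hv0
  refine eq_top_iff.2 fun w _ => ?_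
  have hw : (vecMulVec w (Pi.single j (v j)⁻¹)).mulVec v = w := by
    rw [vecMulVec_mulVec]
    simp [inv_mul_cancel₀ hj]
  exact hw ▸ hall _ v hv

/-- Over an algebraically closed field, the words in an irreducible tuple of matrices span the full
matrix algebra. -/
theorem span_wordProd_eq_top [IsAlgClosed k] [Nonempty m] {M : ι → Matrix m m k}
    (hM : ∀ U : Submodule k (m → k), (∀ i, ∀ v ∈ U, (M i).mulVec v ∈ U) → U = ⊥ ∨ U = ⊤) :
    Submodule.span k (Set.range (wordProd M)) = ⊤ := by
  have hadj : Algebra.adjoin k (Set.range M) = ⊤ := by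
    have h := Subalgebra.eq_top_of_forall_invariant
      ((Algebra.adjoin k (Set.range M)).map (toLinAlgEquiv' (R := k) (n := m)).toAlgHom)
      fun U hU => hM U fun i v hv => hU _
        (Subalgebra.mem_map.2 ⟨M i, Algebra.subset_adjoin ⟨i, rfl⟩, rfl⟩) v hv
    refine eq_top_iff.2 fun B _ => ?_
    obtain ⟨C, hC, hCB⟩ := Subalgebra.mem_map.1
      (h ▸ Algebra.mem_top : toLinAlgEquiv' B ∈ Subalgebra.map _ _)
    exact toLinAlgEquiv'.injective hCB ▸ hC
  have hcl : (Submonoid.closure (Set.range M) : Set (Matrix m m k)) ⊆ Set.range (wordProd M) := by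
    rw [← FreeMonoid.mrange_lift]
    rintro _ ⟨l, rfl⟩
    exact ⟨l.toList, (FreeMonoid.lift_apply M l).symm⟩
  rw [eq_top_iff, ← Algebra.top_toSubmodule, ← hadj, Algebra.adjoin_eq_span]
  exact Submodule.span_mono hcl

theorem differentiable_wordProd {ρ : ι → ℂ → Matrix m m ℂ}
    (hρ : ∀ i j j', Differentiable ℂ fun h => ρ i h j j') (l : List ι) :
    ∀ j j', Differentiable ℂ fun h => wordProd (fun i => ρ i h) l j j' := by
  induction l with
  | nil => simp [wordProd]
  | cons i l ih =>
    intro j j'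
    simp only [wordProd, List.map_cons, List.prod_cons, mul_apply]
    exact Differentiable.fun_sum fun q _ => (hρ i j q).mul (ih q j')

theorem differentiable_det {ρ : ℂ → Matrix m m ℂ}
    (hρ : ∀ j j', Differentiable ℂ fun h => ρ h j j') : Differentiable ℂ fun h => (ρ h).det := by
  simp only [det_apply]
  fun_prop

end Matrix


/-- an analytic (entire) curve of `r`-tuples of invertible `n × n` matrices is
either reducible for every value of the parameter, or the set of reducible parameter values has
no accumulation point in `ℂ` (generic irreducibility). -/
theorem analytic_curve_reducibility_dichotomy (n r : ℕ) (hn : 0 < n) (hr : 0 < r)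
    (ρ : Fin r → ℂ → Matrix (Fin n) (Fin n) ℂ)
    (hinv : ∀ i h, IsUnit (ρ i h))
    (hent : ∀ (i : Fin r) (j k : Fin n), Differentiable ℂ fun h : ℂ => ρ i h j k) :
    (∀ h : ℂ, ∃ U : Submodule ℂ (Fin n → ℂ), U ≠ ⊥ ∧ U ≠ ⊤ ∧
        ∀ i : Fin r, ∀ v ∈ U, (ρ i h).mulVec v ∈ U) ∨
      ∀ z : ℂ, ¬ AccPt z (Filter.principal
        {h : ℂ | ∃ U : Submodule ℂ (Fin n → ℂ), U ≠ ⊥ ∧ U ≠ ⊤ ∧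
          ∀ i : Fin r, ∀ v ∈ U, (ρ i h).mulVec v ∈ U}) := by
  rw [or_iff_not_imp_left]
  intro hirr z hz
  push Not at hirr
  obtain ⟨h₀, hh₀⟩ := hirr
  have : Nonempty (Fin n) := ⟨⟨0, hn⟩⟩
  have hspan : Submodule.span ℂ (Set.range (Matrix.wordProd fun i => ρ i h₀)) = ⊤ := by
    refine Matrix.span_wordProd_eq_top fun U hU => or_iff_not_imp_left.2 fun hbot => ?_
    by_contra htop
    obtain ⟨i, v, hv, hv'⟩ := hh₀ U hbot htop
    exact hv' (hU i v hv)
  obtain ⟨κ, a, -, ha, hli⟩ := exists_linearIndependent' ℂ (Matrix.wordProd fun i => ρ i h₀)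
  rw [hspan] at ha
  let e := (Module.Basis.mk hli ha.ge).indexEquiv (Matrix.stdBasis ℂ (Fin n) (Fin n))
  let b := Matrix.stdBasis ℂ (Fin n) (Fin n)
  let D : ℂ → ℂ := fun h => b.det fun p => Matrix.wordProd (fun i => ρ i h) (a (e.symm p))
  have hD : Differentiable ℂ D := by
    simp only [D, Module.Basis.det_apply]
    refine Matrix.differentiable_det fun p q => ?_
    simpa [b, Module.Basis.toMatrix_apply, Matrix.stdBasis] using
      Matrix.differentiable_wordProd hent _ _ _
  have hD₀ : D h₀ ≠ 0 := by
    refine IsUnit.ne_zero ((Module.Basis.is_basis_iff_det b).1 ⟨hli.comp _ e.symm.injective, ?_⟩)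
    rw [← ha]
    exact congrArg _ (e.symm.surjective.range_comp (Matrix.wordProd (fun i => ρ i h₀) ∘ a))
  have hred : ∃ᶠ h in nhdsWithin z {z}ᶜ, D h = 0 := by
    refine (accPt_iff_frequently_nhdsNE.1 hz).mono fun h ⟨U, hbot, htop, hU⟩ => ?_
    by_contra hne
    have hs := ((Module.Basis.is_basis_iff_det b).2 (isUnit_iff_ne_zero.2 hne)).2
    exact (Matrix.eq_bot_or_eq_top_of_span_wordProd hs hU).elim hbot htop
  have hana : AnalyticOnNhd ℂ D Set.univ := hD.differentiableOn.analyticOnNhd isOpen_univ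
  exact hD₀ (hana.eqOn_zero_of_preconnected_of_frequently_eq_zero isPreconnected_univ
    (Set.mem_univ z) hred (Set.mem_univ h₀))
end

section
/- Let V be a finite-dimensional g-module, let α_i be a simple root (for a fixed system of simple roots) with chosen sl₂-triple e_i ∈ g_{α_i}, f_i ∈ g_{−α_i}, [e_i, f_i] = h_{α_i}, and let τ_i ∈ GL(V) be the operator exp(e_i) ∘ exp(−f_i) ∘ exp(e_i), where exp denotes the exponential of the corresponding (nilpotent) endomorphisms of V. Then every linear subspace U ⊆ V[0] of the zero weight space that is invariant under the action of κ_{α_i} is invariant under τ_i. Consequently, V[0] is irreducible under the operators {κ_α}_{α∈R} if and only if it is irreducible under the operators {κ_α}_{α∈R} together with all the τ_i. -/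
open LieAlgebra UniversalEnvelopingAlgebra

/-- The exponential of a (nilpotent) endomorphism of a finite-dimensional space, given by the
finite sum `Σ_{k ≤ dim V} A^k / k!`. -/
noncomputable def expEnd {V : Type} [AddCommGroup V] [Module ℂ V] [FiniteDimensional ℂ V]
    (A : Module.End ℂ V) : Module.End ℂ V :=
  ∑ k ∈ Finset.range (Module.finrank ℂ V + 1), (k.factorial : ℂ)⁻¹ • A ^ k

section ExpSeries

variable {A : Type*} [Ring A] [Algebra ℂ A]

/-- Moving `b` past a power of `a` when the third iterated commutator of `b` with `a` vanishes. -/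
lemma mul_pow_add_two_of_commutators {a b d d' : A} (hd : b * a = a * b + d)
    (hd' : d * a = a * d + d') (hc : d' * a = a * d') (k : ℕ) :
    b * a ^ (k + 2) = a ^ (k + 2) * b + ((k : ℂ) + 2) • (a ^ (k + 1) * d) +
      (((k : ℂ) + 2) * (k + 1) / 2) • (a ^ k * d') := by
  induction k with
  | zero =>
    have h2 : (2 : ℂ) • (a * d) = a * d + a * d := two_smul ℂ _
    simp only [Nat.cast_zero, zero_add, pow_one, pow_zero, one_mul, h2]
    norm_num
    rw [pow_two, ← mul_assoc, hd, add_mul, mul_assoc a b a, hd, hd', mul_add, mul_assoc]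
    abel
  | succ k ih =>
    rw [pow_succ a (k + 2), ← mul_assoc, ih, add_mul, add_mul, smul_mul_assoc, smul_mul_assoc,
      mul_assoc _ b a, mul_assoc _ d a, mul_assoc _ d' a, hd, hd', hc, mul_add, mul_add,
      ← mul_assoc, ← mul_assoc, ← mul_assoc, ← pow_succ, ← pow_succ, ← pow_succ]
    push_cast
    module

lemma mul_sum_exp_of_commutators {a b d d' : A} (hd : b * a = a * b + d)
    (hd' : d * a = a * d + d') (hc : d' * a = a * d') (m : ℕ) :
    b * ∑ k ∈ Finset.range (m + 2), (k.factorial : ℂ)⁻¹ • a ^ k =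
      (∑ k ∈ Finset.range (m + 2), (k.factorial : ℂ)⁻¹ • a ^ k) * b +
        (∑ k ∈ Finset.range (m + 1), (k.factorial : ℂ)⁻¹ • a ^ k) * d +
        (2⁻¹ : ℂ) • ((∑ k ∈ Finset.range m, (k.factorial : ℂ)⁻¹ • a ^ k) * d') := by
  induction m with
  | zero => simp [Finset.sum_range_succ, mul_add, add_mul, hd]; abel
  | succ m ih =>
    have h1 : ((m + 2).factorial : ℂ)⁻¹ * ((m : ℂ) + 2) = ((m + 1).factorial : ℂ)⁻¹ := by
      have : ((m : ℂ) + 2) ≠ 0 := by exact_mod_cast (by omega : m + 2 ≠ 0)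
      have h' : ((m + 1).factorial : ℂ) ≠ 0 := by exact_mod_cast (m + 1).factorial_ne_zero
      rw [Nat.factorial_succ (m + 1)]
      push_cast
      rw [show (m : ℂ) + 1 + 1 = m + 2 by ring]
      field_simp
    have h2 : ((m + 1).factorial : ℂ)⁻¹ * ((m : ℂ) + 1) = (m.factorial : ℂ)⁻¹ := by
      have : ((m : ℂ) + 1) ≠ 0 := by exact_mod_cast (by omega : m + 1 ≠ 0)
      have h' : (m.factorial : ℂ) ≠ 0 := by exact_mod_cast m.factorial_ne_zero
      rw [Nat.factorial_succ m]
      push_cast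
      field_simp
    rw [Finset.sum_range_succ _ (m + 2), mul_add, ih, mul_smul_comm,
      mul_pow_add_two_of_commutators hd hd' hc, smul_add, smul_add, smul_smul, smul_smul,
      Finset.sum_range_succ _ (m + 1), Finset.sum_range_succ _ m]
    rw [show ((m + 2).factorial : ℂ)⁻¹ * (((m : ℂ) + 2) * (m + 1) / 2) =
      2⁻¹ * (m.factorial : ℂ)⁻¹ by rw [← h2, ← h1]; ring, h1]
    simp only [add_mul, smul_mul_assoc]
    module

end ExpSeries

section Exponential

variable {V : Type} [AddCommGroup V] [Module ℂ V] [FiniteDimensional ℂ V]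

lemma expEnd_eq_sum_range {A : Module.End ℂ V} (hA : IsNilpotent A) (j : ℕ) :
    expEnd A = ∑ k ∈ Finset.range (Module.finrank ℂ V + 1 + j), (k.factorial : ℂ)⁻¹ • A ^ k := by
  have h0 : A ^ Module.finrank ℂ V = 0 := by
    have h := A.aeval_self_charpoly
    rwa [hA.charpoly_eq_X_pow_finrank, map_pow, Polynomial.aeval_X] at h
  refine Finset.sum_subset (Finset.range_mono (by omega)) fun k _ hk => ?_
  rw [pow_eq_zero_of_le (by simp at hk; omega) h0, smul_zero]

/-- `exp(A)⁻¹ b exp(A) = b + [b, A] + [[b, A], A] / 2` when the next commutator vanishes. -/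
lemma mul_expEnd_of_commutators {A b d d' : Module.End ℂ V} (hA : IsNilpotent A)
    (hd : b * A = A * b + d) (hd' : d * A = A * d + d') (hc : d' * A = A * d') :
    b * expEnd A = expEnd A * (b + d + (2⁻¹ : ℂ) • d') := by
  have h := mul_sum_exp_of_commutators hd hd' hc (Module.finrank ℂ V + 1)
  rw [← expEnd_eq_sum_range hA 2, add_assoc _ 1 1, ← add_assoc, ← expEnd_eq_sum_range hA 1] at h
  rw [h, mul_add, mul_add, mul_smul_comm]
  rfl

end Exponential

section SlTwo

variable {V : Type} [AddCommGroup V] [Module ℂ V] {E F H : Module.End ℂ V}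

lemma weight_mul_pow {A : Module.End ℂ V} {c : ℂ} (hA : H * A = A * H + c • A) (n : ℕ) :
    H * A ^ n = A ^ n * H + (n * c) • A ^ n := by
  induction n with
  | zero => simp
  | succ n ih =>
    rw [pow_succ, ← mul_assoc, ih, add_mul, mul_assoc, hA, mul_add, smul_mul_assoc,
      mul_smul_comm, ← mul_assoc]
    push_cast
    module

lemma pow_apply_mem_eigenspace {A : Module.End ℂ V} {c μ : ℂ} (hA : H * A = A * H + c • A)
    (n : ℕ) {v : V} (hv : v ∈ H.eigenspace μ) : (A ^ n) v ∈ H.eigenspace (μ + n * c) := by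
  rw [Module.End.mem_eigenspace_iff] at hv ⊢
  have h := LinearMap.congr_fun (weight_mul_pow hA n) v
  simp only [Module.End.mul_apply, LinearMap.add_apply, LinearMap.smul_apply, hv, map_smul] at h
  rw [h]
  module

lemma mul_pow_succ_of_slTwo (hHE : H * E = E * H + (2 : ℂ) • E) (hEF : E * F = F * E + H)
    (n : ℕ) :
    F * E ^ (n + 1) = E ^ n * (F * E) - (n : ℂ) • (E ^ n * H) - ((n : ℂ) * (n + 1)) • E ^ n := by
  induction n with
  | zero => simp
  | succ n ih =>
    have hFE : F * E = E * F - H := by rw [hEF]; abel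
    rw [pow_succ E (n + 1), ← mul_assoc, ih, sub_mul, sub_mul, smul_mul_assoc, smul_mul_assoc,
      mul_assoc (E ^ n) H E, hHE, ← pow_succ]
    have h1 : E ^ n * (F * E) * E = E ^ (n + 1) * (F * E) - E ^ (n + 1) * H
        - (2 : ℂ) • E ^ (n + 1) := by
      have h2 : F * E * E = E * (F * E) - E * H - (2 : ℂ) • E := by
        nth_rw 1 [hFE]
        rw [sub_mul, hHE, mul_assoc]
        abel
      rw [mul_assoc, h2, mul_sub, mul_sub, mul_smul_comm, pow_succ, mul_assoc, mul_assoc]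
    rw [h1, mul_add, mul_smul_comm, ← mul_assoc (E ^ n) E H, ← pow_succ]
    push_cast
    module

/-- A subspace of `ker H` stable under `F E` is stable under every `F ^ n E ^ n`. -/
lemma pow_pow_apply_mem (hHE : H * E = E * H + (2 : ℂ) • E) (hEF : E * F = F * E + H)
    {U : Submodule ℂ V} (hH : ∀ v ∈ U, H v = 0) (hU : ∀ v ∈ U, F (E v) ∈ U)
    (n : ℕ) : ∀ v ∈ U, (F ^ n) ((E ^ n) v) ∈ U := by
  induction n with
  | zero => simp
  | succ n ih =>
    intro v hv
    have h := LinearMap.congr_fun (mul_pow_succ_of_slTwo hHE hEF n) v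
    simp only [Module.End.mul_apply, LinearMap.sub_apply, LinearMap.smul_apply, hH v hv, map_zero,
      smul_zero, sub_zero] at h
    rw [pow_succ F, Module.End.mul_apply, h, map_sub, map_smul]
    exact U.sub_mem (ih _ (hU v hv)) (U.smul_mem _ (ih v hv))

variable [FiniteDimensional ℂ V]

/-- The Tits operator of an `sl₂`-triple anticommutes with `H`. -/
lemma weight_mul_tits (hE : IsNilpotent E) (hF : IsNilpotent F)
    (hHE : H * E = E * H + (2 : ℂ) • E) (hHF : H * F = F * H + (-2 : ℂ) • F)
    (hEF : E * F = F * E + H) :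
    H * (expEnd E * expEnd (-F) * expEnd E) = -(expEnd E * expEnd (-F) * expEnd E * H) := by
  have h1 : H * expEnd E = expEnd E * (H + (2 : ℂ) • E) := by
    have := mul_expEnd_of_commutators (d' := 0) hE hHE (by simp) (by simp)
    simpa using this
  have h2 : H * expEnd (-F) = expEnd (-F) * (H + (2 : ℂ) • F) := by
    have := mul_expEnd_of_commutators (b := H) (d := (2 : ℂ) • F) (d' := 0) hF.neg
      (by rw [mul_neg, hHF, neg_mul]; module) (by simp) (by simp)
    simpa using this
  have h3 : E * expEnd (-F) = expEnd (-F) * (E - H - F) := by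
    have := mul_expEnd_of_commutators (b := E) (d := -H) (d' := (-2 : ℂ) • F) hF.neg
      (by rw [mul_neg, hEF, neg_mul]; abel)
      (by rw [neg_mul_neg, hHF, neg_mul_neg]) (by simp)
    rw [this]
    congr 1
    module
  have h4 : E * expEnd E = expEnd E * E := by
    have := mul_expEnd_of_commutators (b := E) (d := 0) (d' := 0) hE (by simp) (by simp) (by simp)
    simpa using this
  have h5 : (H + (2 : ℂ) • E) * expEnd (-F) = expEnd (-F) * (-H + (2 : ℂ) • E) := by
    rw [add_mul, smul_mul_assoc, h2, h3, ← mul_smul_comm, ← mul_add]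
    congr 1
    module
  have h6 : (-H + (2 : ℂ) • E) * expEnd E = expEnd E * (-H) := by
    rw [add_mul, smul_mul_assoc, neg_mul, h1, h4, ← mul_smul_comm, ← mul_neg, ← mul_add]
    congr 1
    abel
  calc _ = H * expEnd E * expEnd (-F) * expEnd E := by simp only [mul_assoc]
    _ = expEnd E * ((H + (2 : ℂ) • E) * expEnd (-F)) * expEnd E := by
      rw [h1]; simp only [mul_assoc]
    _ = expEnd E * expEnd (-F) * ((-H + (2 : ℂ) • E) * expEnd E) := by
      rw [h5]; simp only [mul_assoc]
    _ = _ := by rw [h6]; simp only [mul_assoc, mul_neg]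

/-- A subspace of `ker H` stable under `F E` is stable under the Tits operator: the monomials of
the triple product that do not preserve the weight cancel, and the others are polynomials in
`F E`. -/
lemma tits_apply_mem (hE : IsNilpotent E) (hF : IsNilpotent F)
    (hHE : H * E = E * H + (2 : ℂ) • E) (hHF : H * F = F * H + (-2 : ℂ) • F)
    (hEF : E * F = F * E + H) {U : Submodule ℂ V} (hH : ∀ v ∈ U, H v = 0)
    (hU : ∀ v ∈ U, F (E v) ∈ U) {v : V} (hv : v ∈ U) :
    (expEnd E * expEnd (-F) * expEnd E) v ∈ U := by
  have hFE : ∀ (n : ℕ), ∀ u ∈ U, (F ^ n) ((E ^ n) u) ∈ U := pow_pow_apply_mem hHE hEF hH hU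
  have hEFpow : ∀ (n : ℕ), ∀ u ∈ U, (E ^ n) ((F ^ n) u) ∈ U := by
    refine pow_pow_apply_mem (H := -H) ?_ ?_ (by simpa using hH) fun u hu => ?_
    · rw [neg_mul, hHF, mul_neg]; module
    · rw [hEF]; abel
    · have h := LinearMap.congr_fun hEF u
      simp only [Module.End.mul_apply, LinearMap.add_apply, hH u hu, add_zero] at h
      exact h ▸ hU u hu
  let W : Submodule ℂ V := ⨆ (μ : ℂ) (_ : μ ≠ 0), H.eigenspace μ
  have hmono : ∀ a b c : ℕ, (E ^ a) (((-F) ^ b) ((E ^ c) v)) ∈ U ⊔ W := by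
    intro a b c
    have hneg : ((-F) ^ b) ((E ^ c) v) = (-1 : ℂ) ^ b • (F ^ b) ((E ^ c) v) := by
      rw [← neg_one_smul ℂ F, smul_pow, LinearMap.smul_apply]
    rw [hneg, map_smul]
    refine Submodule.smul_mem _ _ ?_
    by_cases hb : b = a + c
    · subst hb
      refine Submodule.mem_sup_left ?_
      rw [pow_add, Module.End.mul_apply]
      exact hEFpow a _ (hFE c v hv)
    · refine Submodule.mem_sup_right ?_
      have h0 : v ∈ H.eigenspace 0 := by simp [hH v hv]
      have h := pow_apply_mem_eigenspace hHE a (pow_apply_mem_eigenspace hHF b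
        (pow_apply_mem_eigenspace hHE c h0))
      refine Submodule.mem_iSup_of_mem _ (Submodule.mem_iSup_of_mem ?_ h)
      intro hz
      apply hb
      have h2 : (b : ℂ) = ((a + c : ℕ) : ℂ) := by
        push_cast
        linear_combination (-1 / 2 : ℂ) * hz
      exact_mod_cast h2
  have hexp : ∀ (A : Module.End ℂ V) (S : Submodule ℂ V) (x : V),
      (∀ k : ℕ, (A ^ k) x ∈ S) → expEnd A x ∈ S := by
    intro A S x h
    rw [expEnd, LinearMap.sum_apply]
    exact S.sum_mem fun k _ => S.smul_mem _ (h k)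
  have hmem : (expEnd E * expEnd (-F) * expEnd E) v ∈ U ⊔ W := by
    rw [Module.End.mul_apply, Module.End.mul_apply]
    refine hexp E _ _ fun a => ?_
    change _ ∈ (U ⊔ W).comap (E ^ a)
    refine hexp (-F) _ _ fun b => ?_
    change _ ∈ ((U ⊔ W).comap (E ^ a)).comap ((-F) ^ b)
    exact hexp E _ _ fun c => hmono a b c
  have hker : H ((expEnd E * expEnd (-F) * expEnd E) v) = 0 := by
    have h := LinearMap.congr_fun (weight_mul_tits hE hF hHE hHF hEF) v
    rw [Module.End.mul_apply, LinearMap.neg_apply, Module.End.mul_apply _ H, hH v hv, map_zero,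
      neg_zero] at h
    exact h
  obtain ⟨u, hu, w, hw, huw⟩ := Submodule.mem_sup.mp hmem
  have hw0 : w ∈ H.eigenspace 0 := by
    rw [← huw, map_add, hH u hu, zero_add] at hker
    simp [hker]
  have : w = 0 := Submodule.disjoint_def.mp (H.eigenspaces_iSupIndep 0) w hw0 hw
  rw [← huw, this, add_zero]
  exact hu

end SlTwo

section RootVectors

variable {L : Type} [LieRing L] [LieAlgebra ℂ L]

/-- The element dual to a root `α` under a multiple of the Killing form has nonzero length: it is
proportional to the coroot. -/
lemma apply_dual_self_ne_zero {H : LieSubalgebra ℂ L} {c : ℂ}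
    {α : Module.Dual ℂ H} {e f : L} {h tα : H} (hf : IsRootVector H (-α) f) (hef : ⁅e, f⁆ = h)
    (hα : α h = 2) (ht : ∀ x : H, (c • killingForm ℂ L) tα x = α x) :
    (c • killingForm ℂ L) tα tα ≠ 0 := by
  intro h0
  have h1 : (c • killingForm ℂ L) (tα : L) (h : L) = 2 := by rw [ht, hα]
  have h2 : ⁅f, (tα : L)⁆ = α tα • f := by
    rw [← lie_skew, hf]; simp
  rw [ht] at h0
  have h3 : killingForm ℂ L (tα : L) (h : L) = 0 := by
    rw [LieModule.traceForm_comm, ← hef, LieModule.traceForm_apply_lie_apply, h2, h0, zero_smul,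
      map_zero]
  simp [h3] at h1

end RootVectors

/-- every subspace of the zero weight space invariant under the truncated Casimir
`κ_{α_i}` of a simple root is invariant under `τ_i = exp(e_i) exp(-f_i) exp(e_i)`; consequently
`V[0]` is irreducible under the `κ_α` iff it is irreducible under the `κ_α` and the `τ_i`. -/
theorem casimir_invariant_subspace_invariant_under_tits
    {L : Type} [LieRing L] [LieAlgebra ℂ L] [FiniteDimensional ℂ L]
    [LieAlgebra.IsSemisimple ℂ L]
    (H : LieSubalgebra ℂ L) [H.IsCartanSubalgebra]
    (c : ℂ) (hc : c ≠ 0)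
    (B : LinearMap.BilinForm ℂ L) (hB : B = c • killingForm ℂ L)
    (R : Set (Module.Dual ℂ H))
    (hR : R = {α | α ≠ 0 ∧ ∃ x : L, x ≠ 0 ∧ IsRootVector H α x})
    (t : Module.Dual ℂ H → H)
    (ht : ∀ α ∈ R, ∀ x : H, B (t α) x = α x)
    (e f : Module.Dual ℂ H → L) (hcoroot : Module.Dual ℂ H → H)
    (he : ∀ α ∈ R, IsRootVector H α (e α) ∧ e α ≠ 0)
    (hf : ∀ α ∈ R, IsRootVector H (-α) (f α) ∧ f α ≠ 0)
    (hef : ∀ α ∈ R, ⁅e α, f α⁆ = (hcoroot α : L))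
    (hcoroot2 : ∀ α ∈ R, α (hcoroot α) = 2)
    (κ : Module.Dual ℂ H → UniversalEnvelopingAlgebra ℂ L)
    (hκ : ∀ α ∈ R, κ α = (B (t α) (t α) / 2) •
      (ι ℂ (e α) * ι ℂ (f α) + ι ℂ (f α) * ι ℂ (e α)))
    -- a fixed system of simple roots
    (Δ : Finset (Module.Dual ℂ H)) (hΔR : (Δ : Set (Module.Dual ℂ H)) ⊆ R)
    (hΔind : LinearIndependent ℂ (Subtype.val : {x // x ∈ Δ} → Module.Dual ℂ H))
    (hΔbase : ∀ β ∈ R, ∃ k : Δ → ℕ,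
      β = ∑ a : Δ, (k a : ℂ) • (a : Module.Dual ℂ H) ∨
      β = -∑ a : Δ, (k a : ℂ) • (a : Module.Dual ℂ H))
    -- a finite-dimensional `g`-module `V`
    {V : Type} [AddCommGroup V] [Module ℂ V] [LieRingModule L V] [LieModule ℂ L V]
    [FiniteDimensional ℂ V]
    -- the root vectors act nilpotently on `V`
    (hnile : ∀ α ∈ R, IsNilpotent (LieModule.toEnd ℂ L V (e α)))
    (hnilf : ∀ α ∈ R, IsNilpotent (LieModule.toEnd ℂ L V (f α)))
    -- the action of `U(g)` on `V`
    (ρ : UniversalEnvelopingAlgebra ℂ L →ₐ[ℂ] Module.End ℂ V)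
    (hρ : ρ = (UniversalEnvelopingAlgebra.lift ℂ) (LieModule.toEnd ℂ L V))
    -- the operators `τ_i = exp(e_i) ∘ exp(-f_i) ∘ exp(e_i)`
    (τ : Module.Dual ℂ H → Module.End ℂ V)
    (hτ : ∀ α ∈ Δ, τ α =
      expEnd (LieModule.toEnd ℂ L V (e α)) *
        expEnd (LieModule.toEnd ℂ L V (-(f α))) *
          expEnd (LieModule.toEnd ℂ L V (e α))) :
    -- first claim: subspaces of `V[0]` invariant under `κ_{α_i}` are invariant under `τ_i`
    (∀ α ∈ Δ, ∀ U : Submodule ℂ V,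
      (∀ v ∈ U, ∀ s : H, ⁅(s : L), v⁆ = 0) →
      (∀ v ∈ U, ρ (κ α) v ∈ U) →
      ∀ v ∈ U, τ α v ∈ U) ∧
    -- consequence: `V[0]` is irreducible under the `κ_α` iff it is irreducible under the `κ_α`
    -- together with all the `τ_i`
    ((∀ U : Submodule ℂ V,
        (∀ v ∈ U, ∀ s : H, ⁅(s : L), v⁆ = 0) →
        (∀ α ∈ R, ∀ v ∈ U, ρ (κ α) v ∈ U) →
        (U = ⊥ ∨ ∀ v : V, (∀ s : H, ⁅(s : L), v⁆ = 0) → v ∈ U)) ↔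
      (∀ U : Submodule ℂ V,
        (∀ v ∈ U, ∀ s : H, ⁅(s : L), v⁆ = 0) →
        (∀ α ∈ R, ∀ v ∈ U, ρ (κ α) v ∈ U) →
        (∀ α ∈ Δ, ∀ v ∈ U, τ α v ∈ U) →
        (U = ⊥ ∨ ∀ v : V, (∀ s : H, ⁅(s : L), v⁆ = 0) → v ∈ U))) := by
  have key : ∀ α ∈ Δ, ∀ U : Submodule ℂ V,
      (∀ v ∈ U, ∀ s : H, ⁅(s : L), v⁆ = 0) → (∀ v ∈ U, ρ (κ α) v ∈ U) →
      ∀ v ∈ U, τ α v ∈ U := by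
    intro α hα U hU0 hUκ v hv
    have hαR : α ∈ R := hΔR hα
    subst hB
    have hne := apply_dual_self_ne_zero (hf α hαR).1 (hef α hαR) (hcoroot2 α hαR) (ht α hαR)
    have hEF : LieModule.toEnd ℂ L V (e α) * LieModule.toEnd ℂ L V (f α) =
        LieModule.toEnd ℂ L V (f α) * LieModule.toEnd ℂ L V (e α) +
          LieModule.toEnd ℂ L V (hcoroot α : L) := by
      ext w
      simp only [Module.End.mul_apply, LinearMap.add_apply, LieModule.toEnd_apply_apply]
      rw [leibniz_lie, hef α hαR, add_comm]
    have hHE : LieModule.toEnd ℂ L V (hcoroot α : L) * LieModule.toEnd ℂ L V (e α) =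
        LieModule.toEnd ℂ L V (e α) * LieModule.toEnd ℂ L V (hcoroot α : L) +
          (2 : ℂ) • LieModule.toEnd ℂ L V (e α) := by
      ext w
      simp only [Module.End.mul_apply, LinearMap.add_apply, LinearMap.smul_apply,
        LieModule.toEnd_apply_apply]
      rw [leibniz_lie, (he α hαR).1, hcoroot2 α hαR, smul_lie, add_comm]
    have hHF : LieModule.toEnd ℂ L V (hcoroot α : L) * LieModule.toEnd ℂ L V (f α) =
        LieModule.toEnd ℂ L V (f α) * LieModule.toEnd ℂ L V (hcoroot α : L) +
          (-2 : ℂ) • LieModule.toEnd ℂ L V (f α) := by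
      ext w
      simp only [Module.End.mul_apply, LinearMap.add_apply, LinearMap.smul_apply,
        LieModule.toEnd_apply_apply]
      rw [leibniz_lie, (hf α hαR).1, LinearMap.neg_apply, hcoroot2 α hαR, smul_lie, add_comm]
    rw [hτ α hα, map_neg]
    refine tits_apply_mem (hnile α hαR) (hnilf α hαR) hHE hHF hEF
      (fun u hu => hU0 u hu (hcoroot α)) (fun u hu => ?_) hv
    have hκu := hUκ u hu
    have hEFu := LinearMap.congr_fun hEF u
    have hHu : LieModule.toEnd ℂ L V (hcoroot α : L) u = 0 := hU0 u hu (hcoroot α)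
    simp only [Module.End.mul_apply, LinearMap.add_apply, hHu, add_zero] at hEFu
    rw [hκ α hαR, hρ, map_smul, map_add, map_mul, map_mul, lift_ι_apply, lift_ι_apply,
      LinearMap.smul_apply, LinearMap.add_apply, Module.End.mul_apply, Module.End.mul_apply, hEFu,
      ← two_smul ℂ, smul_smul, div_mul_cancel₀ _ two_ne_zero] at hκu
    exact (U.smul_mem_iff hne).mp hκu
  exact ⟨key, fun h U h0 hκU _ => h U h0 hκU,
    fun h U h0 hκU => h U h0 hκU fun α hα => key α hα U h0 (hκU α (hΔR hα))⟩
end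

section
/- Suppose g is simple of rank l with dim g > 3l (equivalently, g is simple and not isomorphic to sl₂(ℂ)). Let b : g ⊗ g → g be the g-module map with b(u ⊗ v) = [u, v], let Alt ⊆ g ⊗ g be the span of all u ⊗ v − v ⊗ u, let V = Alt ∩ ker b (the kernel of the commutator map on Λ²g), and let W ⊆ g ⊗ g be the span of {t₁ ⊗ t₂ − t₂ ⊗ t₁ : t₁, t₂ ∈ h}. Then W is contained in the zero weight space V[0], W is invariant under the actions of h and of every truncated Casimir κ_α (α ∈ R), and 0 ≠ W ≠ V[0]. In particular, V[0] is reducible under the Casimir algebra C(g). -/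
open LieAlgebra UniversalEnvelopingAlgebra TensorProduct

/-- A finite set on which an involution has no fixed points contains a subset of at least half its
size that meets each orbit of the involution at most once. -/
lemma Finset.exists_half_of_involutive {ι : Type*} (s : Finset ι) (σ : ι → ι)
    (hσ : Function.Involutive σ) (hs : ∀ a ∈ s, σ a ≠ a) :
    ∃ S ⊆ s, s.card ≤ 2 * S.card ∧ ∀ a ∈ S, ∀ b ∈ S, σ a ≠ b := by
  classical
  let _ : LinearOrder ι := linearOrderOfSTO (WellOrderingRel (α := ι))
  refine ⟨s.filter (fun a ↦ a < σ a ∨ σ a ∉ s), Finset.filter_subset _ _, ?_, ?_⟩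
  · have hsub : s ⊆ s.filter (fun a ↦ a < σ a ∨ σ a ∉ s) ∪
        (s.filter (fun a ↦ a < σ a ∨ σ a ∉ s)).image σ := by
      intro a ha
      rcases lt_or_gt_of_ne (hs a ha) with h | h
      · by_cases hm : σ a ∈ s
        · exact Finset.mem_union_right _ (Finset.mem_image.mpr
            ⟨σ a, by simp [hm, hσ a, h], hσ a⟩)
        · exact Finset.mem_union_left _ (by simp [ha, hm])
      · exact Finset.mem_union_left _ (by simp [ha, h])
    have h1 := Finset.card_le_card hsub
    have h2 := Finset.card_union_le (s.filter (fun a ↦ a < σ a ∨ σ a ∉ s))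
      ((s.filter (fun a ↦ a < σ a ∨ σ a ∉ s)).image σ)
    have h3 := Finset.card_image_le (s := s.filter (fun a ↦ a < σ a ∨ σ a ∉ s)) (f := σ)
    omega
  · rintro a ha b hb rfl
    simp only [Finset.mem_filter, hσ a] at ha hb
    rcases ha.2 with h | h
    · rcases hb.2 with h' | h'
      · exact lt_asymm h h'
      · exact h' ha.1
    · exact h hb.1

/-- The dimension of a finite sum of submodules is at most the sum of the dimensions. -/
lemma Submodule.finrank_finset_sup_le {K M ι : Type*} [Field K] [AddCommGroup M] [Module K M]
    [FiniteDimensional K M] (s : Finset ι) (f : ι → Submodule K M) :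
    Module.finrank K (s.sup f : Submodule K M) ≤ ∑ i ∈ s, Module.finrank K (f i) := by
  classical
  induction s using Finset.induction_on with
  | empty => simp
  | insert a s ha ih =>
    rw [Finset.sup_insert, Finset.sum_insert ha]
    exact (Submodule.finrank_add_le_finrank_add_finrank _ _).trans (by omega)

section Killing

variable {K L : Type*} [Field K] [CharZero K] [LieRing L] [LieAlgebra K L]
  [FiniteDimensional K L] [LieAlgebra.IsKilling K L]
  (H : LieSubalgebra K L) [H.IsCartanSubalgebra] [LieModule.IsTriangularizable K H L]

/-- The dimension of a Killing Lie algebra is at most its rank plus the number of roots. -/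
lemma LieAlgebra.IsKilling.finrank_le_finrank_add_card_root :
    Module.finrank K L ≤ Module.finrank K H + H.root.card := by
  classical
  have htop : (⊤ : Submodule K L) ≤ H.toSubmodule ⊔
      H.root.sup (fun α ↦ (rootSpace H α).toSubmodule) := by
    have h := LieModule.iSup_genWeightSpace_eq_top' K H L
    rw [← LieSubmodule.toSubmodule_inj, LieSubmodule.iSup_toSubmodule,
      LieSubmodule.top_toSubmodule] at h
    rw [← h]
    refine iSup_le fun α ↦ ?_
    by_cases hα : α.IsZero
    · refine le_trans (le_of_eq ?_) le_sup_left
      have h0 : rootSpace H (0 : H → K) = H.toLieSubmodule := rootSpace_zero_eq K L H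
      rw [hα.eq]
      exact congrArg LieSubmodule.toSubmodule h0
    · exact le_trans (Finset.le_sup (f := fun α : LieModule.Weight K H L ↦
        (rootSpace H α).toSubmodule) (by simpa using hα)) le_sup_right
  have h1 := Submodule.finrank_mono htop
  have h2 := Submodule.finrank_add_le_finrank_add_finrank H.toSubmodule
    (H.root.sup (fun α ↦ (rootSpace H α).toSubmodule))
  have h3 := Submodule.finrank_finset_sup_le H.root (fun α ↦ (rootSpace H α).toSubmodule)
  have h4 : ∑ α ∈ H.root, Module.finrank K (rootSpace H α).toSubmodule = H.root.card := by
    rw [Finset.card_eq_sum_ones]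
    exact Finset.sum_congr rfl fun α hα ↦ finrank_rootSpace_eq_one α (by simpa using hα)
  rw [finrank_top] at h1
  have h5 : Module.finrank K H.toSubmodule = Module.finrank K H := rfl
  omega

/-- A Killing Lie algebra of rank at most one has dimension at most three times its rank. -/
lemma LieAlgebra.IsKilling.finrank_le_three_mul_of_finrank_le_one
    (h : Module.finrank K H ≤ 1) : Module.finrank K L ≤ 3 * Module.finrank K H := by
  classical
  have hle := finrank_le_finrank_add_card_root H
  rcases H.root.eq_empty_or_nonempty with h0 | ⟨α, hα⟩
  · rw [h0, Finset.card_empty] at hle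
    omega
  have hα' : α.IsNonZero := by simpa using hα
  have hdual : Module.finrank K (Module.Dual K H) = Module.finrank K H :=
    Subspace.dual_finrank_eq
  have hα0 : LieModule.Weight.toLinear K H L α ≠ 0 := by simpa using hα'
  have hpos : 0 < Module.finrank K (Module.Dual K H) :=
    Module.finrank_pos_iff_exists_ne_zero.mpr ⟨_, hα0⟩
  have hone : Module.finrank K (Module.Dual K H) = 1 := by omega
  have hsub : H.root ⊆ {-α, α} := by
    intro β hβ
    obtain ⟨k, hk⟩ := (finrank_eq_one_iff_of_nonzero' _ hα0).mp hone
      (LieModule.Weight.toLinear K H L β)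
    have := eq_neg_or_eq_of_eq_smul α β (by simpa using hβ) k (by
      ext x
      simpa using (LinearMap.congr_fun hk x).symm)
    simpa using this
  have := (Finset.card_le_card hsub).trans Finset.card_le_two
  omega

end Killing

/-- for `g` simple with `dim g > 3·rank g`, in the kernel `V` of the commutator map
on `Λ²g ⊆ g ⊗ g` the subspace `W = h ∧ h` is a proper nonzero subspace of the zero weight space
`V[0]` invariant under `h` and all truncated Casimirs; hence `V[0]` is reducible under the
Casimir algebra `C(g)`. -/
theorem zero_weight_space_of_ker_commutator_reducible
    {L : Type} [LieRing L] [LieAlgebra ℂ L] [FiniteDimensional ℂ L]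
    [LieAlgebra.IsSimple ℂ L]
    (H : LieSubalgebra ℂ L) [H.IsCartanSubalgebra]
    (hrank : Module.finrank ℂ L > 3 * Module.finrank ℂ H)
    (c : ℂ) (hc : c ≠ 0)
    (B : LinearMap.BilinForm ℂ L) (hB : B = c • killingForm ℂ L)
    (R : Set (Module.Dual ℂ H))
    (hR : R = {α | α ≠ 0 ∧ ∃ x : L, x ≠ 0 ∧ IsRootVector H α x})
    (t : Module.Dual ℂ H → H)
    (ht : ∀ α ∈ R, ∀ x : H, B (t α) x = α x)
    (e f : Module.Dual ℂ H → L) (hcoroot : Module.Dual ℂ H → H)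
    (he : ∀ α ∈ R, IsRootVector H α (e α) ∧ e α ≠ 0)
    (hf : ∀ α ∈ R, IsRootVector H (-α) (f α) ∧ f α ≠ 0)
    (hef : ∀ α ∈ R, ⁅e α, f α⁆ = (hcoroot α : L))
    (hcoroot2 : ∀ α ∈ R, α (hcoroot α) = 2)
    (κ : Module.Dual ℂ H → UniversalEnvelopingAlgebra ℂ L)
    (hκ : ∀ α ∈ R, κ α = (B (t α) (t α) / 2) •
      (ι ℂ (e α) * ι ℂ (f α) + ι ℂ (f α) * ι ℂ (e α)))
    -- the commutator map `b : g ⊗ g → g`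
    (b : L ⊗[ℂ] L →ₗ[ℂ] L) (hb : ∀ u v : L, b (u ⊗ₜ[ℂ] v) = ⁅u, v⁆)
    -- the span of antisymmetric tensors
    (Alt : Submodule ℂ (L ⊗[ℂ] L))
    (hAlt : Alt = Submodule.span ℂ {x | ∃ u v : L, x = u ⊗ₜ[ℂ] v - v ⊗ₜ[ℂ] u})
    -- `V = Λ²g ∩ ker b`
    (V : Submodule ℂ (L ⊗[ℂ] L)) (hV : V = Alt ⊓ LinearMap.ker b)
    -- `W = h ∧ h`
    (W : Submodule ℂ (L ⊗[ℂ] L))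
    (hW : W = Submodule.span ℂ
      {x | ∃ t₁ t₂ : H, x = (t₁ : L) ⊗ₜ[ℂ] (t₂ : L) - (t₂ : L) ⊗ₜ[ℂ] (t₁ : L)})
    -- the action of `U(g)` on `g ⊗ g`
    (ρ : UniversalEnvelopingAlgebra ℂ L →ₐ[ℂ] Module.End ℂ (L ⊗[ℂ] L))
    (hρ : ρ = (UniversalEnvelopingAlgebra.lift ℂ) (LieModule.toEnd ℂ L (L ⊗[ℂ] L))) :
    -- `W` is contained in the zero weight space of `V`
    (W ≤ V ∧ ∀ x ∈ W, ∀ s : H, ⁅(s : L), x⁆ = 0) ∧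
    -- `W` is invariant under `h` and under every truncated Casimir
    (∀ s : H, ∀ x ∈ W, ⁅(s : L), x⁆ ∈ W) ∧
    (∀ α ∈ R, ∀ x ∈ W, ρ (κ α) x ∈ W) ∧
    -- `0 ≠ W ≠ V[0]`
    W ≠ ⊥ ∧ (∃ x ∈ V, (∀ s : H, ⁅(s : L), x⁆ = 0) ∧ x ∉ W) := by
  classical
  have : LieAlgebra.IsKilling ℂ L := inferInstance
  have hab : ∀ s s' : H, ⁅(s : L), (s' : L)⁆ = 0 := fun s s' ↦ by
    rw [← LieSubalgebra.coe_bracket, trivial_lie_zero, ZeroMemClass.coe_zero]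
  have hwedge : ∀ t₁ t₂ : H, (t₁ : L) ⊗ₜ[ℂ] (t₂ : L) - (t₂ : L) ⊗ₜ[ℂ] (t₁ : L) ∈ W :=
    fun t₁ t₂ ↦ hW ▸ Submodule.subset_span ⟨t₁, t₂, rfl⟩
  have hWV : W ≤ V := by
    rw [hW, hV, hAlt, Submodule.span_le]
    rintro _ ⟨t₁, t₂, rfl⟩
    exact ⟨Submodule.subset_span ⟨t₁, t₂, rfl⟩, by simp [hb, hab]⟩
  have hW0 : ∀ x ∈ W, ∀ s : H, ⁅(s : L), x⁆ = 0 := by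
    intro x hx s
    rw [hW] at hx
    induction hx using Submodule.span_induction with
    | mem x hx =>
      obtain ⟨t₁, t₂, rfl⟩ := hx
      simp [TensorProduct.LieModule.lie_tmul_right, hab]
    | zero => simp
    | add x y _ _ hx hy => rw [lie_add, hx, hy, add_zero]
    | smul a x _ hx => rw [lie_smul, hx, smul_zero]
  refine ⟨⟨hWV, hW0⟩, fun s x hx ↦ ?_, fun α hα x hx ↦ ?_, ?_, ?_⟩
  · rw [hW0 x hx s]
    exact W.zero_mem
  · rw [hW] at hx
    induction hx using Submodule.span_induction with
    | mem x hx =>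
      obtain ⟨t₁, t₂, rfl⟩ := hx
      have he' : ∀ s : H, ⁅e α, (s : L)⁆ = -(α s • e α) := fun s ↦ by
        rw [← lie_skew, (he α hα).1 s]
      have hf' : ∀ s : H, ⁅f α, (s : L)⁆ = α s • f α := fun s ↦ by
        rw [← lie_skew, (hf α hα).1 s, LinearMap.neg_apply, neg_smul, neg_neg]
      have hfe : ⁅f α, e α⁆ = -(hcoroot α : L) := by rw [← lie_skew, hef α hα]
      have key : ρ (κ α) ((t₁ : L) ⊗ₜ[ℂ] (t₂ : L) - (t₂ : L) ⊗ₜ[ℂ] (t₁ : L)) =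
          (B (t α) (t α) / 2 * 2 * α t₁) •
            ((hcoroot α : L) ⊗ₜ[ℂ] (t₂ : L) - (t₂ : L) ⊗ₜ[ℂ] (hcoroot α : L)) +
          (B (t α) (t α) / 2 * 2 * α t₂) •
            ((t₁ : L) ⊗ₜ[ℂ] (hcoroot α : L) - (hcoroot α : L) ⊗ₜ[ℂ] (t₁ : L)) := by
        rw [hκ α hα, hρ]
        simp only [map_smul, map_add, map_mul, lift_ι_apply, LinearMap.smul_apply,
          LinearMap.add_apply, Module.End.mul_apply, LieModule.toEnd_apply_apply, lie_sub,
          lie_add, TensorProduct.LieModule.lie_tmul_right, he', hf', hef α hα, hfe,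
          lie_smul, lie_neg, TensorProduct.tmul_neg, TensorProduct.neg_tmul,
          TensorProduct.tmul_smul, ← TensorProduct.smul_tmul']
        module
      rw [key]
      exact W.add_mem (W.smul_mem _ (hwedge _ _)) (W.smul_mem _ (hwedge _ _))
    | zero => simp
    | add x y _ _ hx hy => rw [map_add]; exact W.add_mem hx hy
    | smul a x _ hx => rw [map_smul]; exact W.smul_mem _ hx
  · intro hbot
    have hrk : 1 < Module.finrank ℂ H := by
      by_contra! hle
      have := IsKilling.finrank_le_three_mul_of_finrank_le_one H hle
      omega
    let v := Module.finBasis ℂ H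
    have hli : LinearIndependent ℂ (fun i ↦ ((v i : H) : L)) :=
      v.linearIndependent.map' H.toSubmodule.subtype (Submodule.ker_subtype _)
    have hne : (⟨0, by omega⟩ : Fin (Module.finrank ℂ H)) ≠ ⟨1, hrk⟩ := by simp
    obtain ⟨φ, hφ⟩ : ∃ φ : Fin (Module.finrank ℂ H) → Module.Dual ℂ L,
        ∀ i j, φ i (v j : L) = if j = i then 1 else 0 := by
      obtain ⟨g, hg⟩ := LinearMap.exists_leftInverse_of_injective H.toSubmodule.subtype
        (Submodule.ker_subtype _)
      refine ⟨fun i ↦ v.coord i ∘ₗ g, fun i j ↦ ?_⟩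
      have : g (v j : L) = v j := LinearMap.congr_fun hg (v j)
      simp [this, Finsupp.single_apply]
    have h0 : (v ⟨0, by omega⟩ : L) ⊗ₜ[ℂ] (v ⟨1, hrk⟩ : L) -
        (v ⟨1, hrk⟩ : L) ⊗ₜ[ℂ] (v ⟨0, by omega⟩ : L) = 0 := by
      simpa [hbot] using hwedge (v ⟨0, by omega⟩) (v ⟨1, hrk⟩)
    have h1 := congr_arg (LinearMap.mul' ℂ ℂ ∘ₗ
      TensorProduct.map (φ ⟨0, by omega⟩) (φ ⟨1, hrk⟩)) h0
    simp [hφ] at h1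
  · have hRmem : ∀ α ∈ H.root, LieModule.Weight.toLinear ℂ H L α ∈ R := by
      intro α hα
      obtain ⟨x, hx, hx0⟩ := α.exists_ne_zero
      rw [hR]
      exact ⟨by simpa using hα, x, hx0,
        fun s ↦ IsKilling.lie_eq_smul_of_mem_rootSpace hx s⟩
    have hmem : ∀ (χ : Module.Dual ℂ H) (x : L), IsRootVector H χ x →
        ∀ g : H → ℂ, (∀ s, χ s = g s) → x ∈ rootSpace H g :=
      fun χ x hx g hg ↦ LieModule.weightSpace_le_genWeightSpace L _
        ((LieModule.mem_weightSpace _ _).mpr fun s ↦ hg s ▸ hx s)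
    obtain ⟨S, hSs, hScard, hS⟩ := H.root.exists_half_of_involutive
      (fun α ↦ -α) neg_neg (fun α hα h ↦ by
        have hα' : α.IsNonZero := by simpa using hα
        refine hα' (funext fun s ↦ ?_)
        have := congr_arg (fun β : LieModule.Weight ℂ H L ↦ β s) h
        simpa [neg_eq_self] using this)
    let lin : LieModule.Weight ℂ H L → Module.Dual ℂ H := LieModule.Weight.toLinear ℂ H L
    have hSR : ∀ α : S, lin α ∈ R := fun α ↦ hRmem _ (hSs α.2)
    have hdep : ¬ LinearIndependent ℂ (fun α : S ↦ hcoroot (lin α)) := fun hli ↦ by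
      have h1 := hli.fintype_card_le_finrank
      have h2 := IsKilling.finrank_le_finrank_add_card_root (K := ℂ) H
      rw [Fintype.card_coe] at h1
      omega
    obtain ⟨a, ha, β, hβ⟩ := Fintype.not_linearIndependent_iff.mp hdep
    let E : S → L := fun α ↦ e (lin α)
    let F : S → L := fun α ↦ f (lin α)
    have hEF : ∀ α, ⁅E α, F α⁆ = (hcoroot (lin α) : L) := fun α ↦ hef _ (hSR α)
    have hE : ∀ α (s : H), ⁅(s : L), E α⁆ = lin α s • E α := fun α ↦ (he _ (hSR α)).1
    have hF : ∀ α (s : H), ⁅(s : L), F α⁆ = -(lin α s) • F α := fun α ↦ (hf _ (hSR α)).1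
    have hEm : ∀ α : S, E α ∈ rootSpace H (α : LieModule.Weight ℂ H L) :=
      fun α ↦ hmem _ _ (he _ (hSR α)).1 _ fun _ ↦ rfl
    have hFm : ∀ α : S, F α ∈ rootSpace H (-(α : LieModule.Weight ℂ H L) : H → ℂ) :=
      fun α ↦ hmem _ _ (hf _ (hSR α)).1 _ fun _ ↦ rfl
    have hHm : ∀ s : H, (s : L) ∈ rootSpace H (0 : H → ℂ) := fun s ↦ by
      rw [rootSpace_zero_eq ℂ L H]
      exact s.2
    have hnz : ∀ α : S, (α : LieModule.Weight ℂ H L).IsNonZero := fun α ↦ by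
      simpa using hSs α.2
    have hKH : ∀ s : H, killingForm ℂ L (F β) s = 0 := fun s ↦
      killingForm_apply_eq_zero_of_mem_rootSpace_of_add_ne_zero ℂ L H (hFm β) (hHm s)
        (by simpa using hnz β)
    have hKF : ∀ α, killingForm ℂ L (F β) (F α) = 0 := fun α ↦
      killingForm_apply_eq_zero_of_mem_rootSpace_of_add_ne_zero ℂ L H (hFm β) (hFm α)
        (fun h ↦ hS α α.2 β β.2 (LieModule.Weight.ext fun s ↦ by
          have := congr_fun h s
          simp only [Pi.add_apply, Pi.neg_apply, Pi.zero_apply] at this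
          simp only [LieModule.Weight.coe_neg, Pi.neg_apply]
          linear_combination this))
    have hKE : ∀ α, α ≠ β → killingForm ℂ L (F β) (E α) = 0 := fun α hα ↦
      killingForm_apply_eq_zero_of_mem_rootSpace_of_add_ne_zero ℂ L H (hFm β) (hEm α)
        (fun h ↦ hα (Subtype.ext (LieModule.Weight.ext fun s ↦ by
          have := congr_fun h s
          simp only [Pi.add_apply, Pi.neg_apply, Pi.zero_apply] at this
          linear_combination this)))
    have hKβ : killingForm ℂ L (F β) (E β) ≠ 0 := by
      intro h
      have h1 := IsKilling.lie_eq_killingForm_smul_of_mem_rootSpace_of_mem_rootSpace_neg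
        (hEm β) (hFm β)
      rw [LieModule.traceForm_comm, h, zero_smul, hEF] at h1
      have h2 := hcoroot2 _ (hSR β)
      rw [show hcoroot (lin β) = 0 from Subtype.ext h1, map_zero] at h2
      norm_num at h2
    refine ⟨∑ α, a α • (E α ⊗ₜ[ℂ] F α - F α ⊗ₜ[ℂ] E α), ?_, ?_, ?_⟩
    · rw [hV, hAlt]
      refine ⟨Submodule.sum_mem _ fun α _ ↦ Submodule.smul_mem _ _
        (Submodule.subset_span ⟨_, _, rfl⟩), ?_⟩
      have hval : ∀ α, b (a α • (E α ⊗ₜ[ℂ] F α - F α ⊗ₜ[ℂ] E α)) =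
          (2 : ℂ) • ((a α • hcoroot (lin α) : H) : L) := fun α ↦ by
        rw [map_smul, map_sub, hb, hb, ← lie_skew (F α), hEF]
        push_cast
        module
      rw [SetLike.mem_coe, LinearMap.mem_ker, map_sum, Finset.sum_congr rfl fun α _ ↦ hval α, ← Finset.smul_sum,
        ← AddSubmonoidClass.coe_finsetSum, ha]
      simp
    · intro s
      rw [lie_sum]
      refine Finset.sum_eq_zero fun α _ ↦ ?_
      simp only [lie_smul, lie_sub, TensorProduct.LieModule.lie_tmul_right, hE, hF,
        TensorProduct.tmul_smul, ← TensorProduct.smul_tmul']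
      module
    · intro hx
      let Φ : L ⊗[ℂ] L →ₗ[ℂ] ℂ := LinearMap.mul' ℂ ℂ ∘ₗ
        TensorProduct.map (killingForm ℂ L (F β)) (killingForm ℂ L (E β))
      have hΦ : ∀ u v, Φ (u ⊗ₜ v) = killingForm ℂ L (F β) u * killingForm ℂ L (E β) v :=
        fun u v ↦ rfl
      have hWΦ : W ≤ LinearMap.ker Φ := by
        rw [hW, Submodule.span_le]
        rintro _ ⟨t₁, t₂, rfl⟩
        simp [hΦ, hKH]
      have h0 := hWΦ hx
      rw [LinearMap.mem_ker, map_sum, Finset.sum_eq_single β] at h0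
      · rw [map_smul, map_sub, hΦ, hΦ, hKF, LieModule.traceForm_comm ℂ L L (E β) (F β)] at h0
        simp [hβ, hKβ] at h0
      · intro α _ hα
        simp [hΦ, hKE α hα, hKF]
      · simp
end

section
/- Suppose g is simple. In the adjoint module g, the zero weight space equals h, and h is irreducible under the Casimir algebra C(g): the only linear subspaces of h invariant under the adjoint action of every truncated Casimir κ_α (α ∈ R) are 0 and h. -/
open LieAlgebra UniversalEnvelopingAlgebra

open LieModule LieAlgebra.IsKilling

section

variable {L : Type} [LieRing L] [LieAlgebra ℂ L] {H : LieSubalgebra ℂ L}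

lemma IsRootVector.lie_eq {α : Module.Dual ℂ H} {x : L} (hx : IsRootVector H α x) (s : H) :
    ⁅x, (s : L)⁆ = -(α s • x) := by
  rw [← lie_skew, hx s]

lemma IsRootVector.mem_rootSpace [H.IsCartanSubalgebra] {α : Module.Dual ℂ H} {x : L}
    (hx : IsRootVector H α x) : x ∈ rootSpace H α :=
  weightSpace_le_genWeightSpace L (α : H → ℂ) ((mem_weightSpace _ x).mpr hx)

variable [FiniteDimensional ℂ L] [H.IsCartanSubalgebra]

lemma isRootVector_of_mem_rootSpace [IsKilling ℂ L] {α : Module.Dual ℂ H} {x : L}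
    (hx : x ∈ rootSpace H α) : IsRootVector H α x :=
  fun s => lie_eq_smul_of_mem_rootSpace hx s

/-- The centralizer of a Cartan subalgebra of a Killing Lie algebra is the subalgebra itself. -/
lemma setOf_forall_lie_eq_zero_eq_cartan [IsKilling ℂ L] :
    {x : L | ∀ s : H, ⁅(s : L), x⁆ = 0} = (H : Set L) := by
  ext x
  refine ⟨fun hx => ?_, fun hx s => ?_⟩
  · have h : IsRootVector H 0 x := fun s => by simpa using hx s
    have h' : x ∈ rootSpace H (0 : H → ℂ) := h.mem_rootSpace
    rw [rootSpace_zero_eq] at h'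
    exact h'
  · exact congrArg Subtype.val (trivial_lie_zero H H s ⟨x, hx⟩)

/-- A vector representing a root with respect to a nonzero multiple of the Killing form is
not isotropic. -/
lemma root_apply_ne_zero_of_smul_killingForm_eq [IsKilling ℂ L] {c : ℂ} {α : Weight ℂ H L}
    (hα : α.IsNonZero) {u : H}
    (hu : ∀ x : H, (c • killingForm ℂ L) (u : L) (x : L) = α x) : α u ≠ 0 := by
  intro h0
  apply root_apply_cartanEquivDual_symm_ne_zero hα
  set s := (cartanEquivDual H).symm α
  have h1 : cartanEquivDual H s u = α u := by
    simp [s]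
  have h2 : killingForm ℂ L (s : L) (u : L) = α u := h1
  have h3 := hu s
  rw [LinearMap.smul_apply, LinearMap.smul_apply, LieModule.traceForm_comm, h2, h0,
    smul_zero] at h3
  exact h3.symm

lemma eq_coroot_of_isRootVector [IsKilling ℂ L] {α : Weight ℂ H L} {e f : L} {h : H}
    (he : IsRootVector H α.toLinear e) (hf : IsRootVector H (-α.toLinear) f)
    (hef : ⁅e, f⁆ = (h : L)) (h2 : α h = 2) : h = coroot α := by
  refine eq_coroot_of_mem_corootSpace_of_two α ?_ h2
  rw [mem_corootSpace]
  exact Submodule.subset_span ⟨e, he.mem_rootSpace, f, hf.mem_rootSpace, hef⟩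

end

/-- The adjoint action of `e f + f e` on the Cartan subalgebra, for opposite root vectors. -/
lemma lift_toEnd_symmetrized_mul_apply {L : Type} [LieRing L] [LieAlgebra ℂ L]
    {H : LieSubalgebra ℂ L} {α : Module.Dual ℂ H} {e f : L} {h : H}
    (he : IsRootVector H α e) (hf : IsRootVector H (-α) f) (hef : ⁅e, f⁆ = (h : L)) (v : H) :
    (UniversalEnvelopingAlgebra.lift ℂ) (LieModule.toEnd ℂ L L)
      (ι ℂ e * ι ℂ f + ι ℂ f * ι ℂ e) (v : L) = (2 * α v) • (h : L) := by
  have hfe : ⁅f, e⁆ = -(h : L) := by rw [← lie_skew, hef]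
  simp only [map_add, map_mul, UniversalEnvelopingAlgebra.lift_ι_apply, LinearMap.add_apply,
    Module.End.mul_apply, LieModule.toEnd_apply_apply, he.lie_eq, hf.lie_eq, lie_neg, lie_smul,
    hef, hfe, LinearMap.neg_apply]
  module

/-- A subspace of a Cartan subalgebra of a simple Lie algebra that contains `α v • coroot α` for
each of its elements `v` and each root `α` is trivial. -/
lemma eq_bot_or_eq_cartan_of_smul_coroot_mem {L : Type} [LieRing L] [LieAlgebra ℂ L]
    [FiniteDimensional ℂ L] [LieAlgebra.IsSimple ℂ L] {H : LieSubalgebra ℂ L}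
    [H.IsCartanSubalgebra] {U : Submodule ℂ L} (hUH : U ≤ H.toSubmodule)
    (hU : ∀ α : Weight ℂ H L, α.IsNonZero → ∀ v : H, (v : L) ∈ U →
      α v • (coroot α : L) ∈ U) :
    U = ⊥ ∨ U = H.toSubmodule := by
  have hmap : (U.comap H.toSubmodule.subtype).map H.toSubmodule.subtype = U := by
    rw [Submodule.map_comap_subtype, inf_eq_right.mpr hUH]
  by_cases hq : U.comap H.toSubmodule.subtype = ⊥
  · left
    rw [← hmap, hq, Submodule.map_bot]
  · right
    have htop := RootPairing.IsIrreducible.eq_top_of_invtSubmodule_coreflection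
      (P := rootSystem H) (U.comap H.toSubmodule.subtype) (fun i v hv => ?_) hq
    · rw [← hmap, htop, Submodule.map_subtype_top]
    · exact U.sub_mem hv (hU i.1 (H.isNonZero_coe_root i) v hv)

/-- for `g` simple, the zero weight space of the adjoint module is `h`, and `h` is
irreducible under the adjoint action of the truncated Casimirs `κ_α`. -/
theorem adjoint_zero_weight_space_casimir_irreducible
    {L : Type} [LieRing L] [LieAlgebra ℂ L] [FiniteDimensional ℂ L]
    [LieAlgebra.IsSimple ℂ L]
    (H : LieSubalgebra ℂ L) [H.IsCartanSubalgebra]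
    (c : ℂ) (hc : c ≠ 0)
    (B : LinearMap.BilinForm ℂ L) (hB : B = c • killingForm ℂ L)
    (R : Set (Module.Dual ℂ H))
    (hR : R = {α | α ≠ 0 ∧ ∃ x : L, x ≠ 0 ∧ IsRootVector H α x})
    (t : Module.Dual ℂ H → H)
    (ht : ∀ α ∈ R, ∀ x : H, B (t α) x = α x)
    (e f : Module.Dual ℂ H → L) (hcoroot : Module.Dual ℂ H → H)
    (he : ∀ α ∈ R, IsRootVector H α (e α) ∧ e α ≠ 0)
    (hf : ∀ α ∈ R, IsRootVector H (-α) (f α) ∧ f α ≠ 0)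
    (hef : ∀ α ∈ R, ⁅e α, f α⁆ = (hcoroot α : L))
    (hcoroot2 : ∀ α ∈ R, α (hcoroot α) = 2)
    (κ : Module.Dual ℂ H → UniversalEnvelopingAlgebra ℂ L)
    (hκ : ∀ α ∈ R, κ α = (B (t α) (t α) / 2) •
      (ι ℂ (e α) * ι ℂ (f α) + ι ℂ (f α) * ι ℂ (e α)))
    -- the adjoint action of `U(g)` on `g`
    (ρ : UniversalEnvelopingAlgebra ℂ L →ₐ[ℂ] Module.End ℂ L)
    (hρ : ρ = (UniversalEnvelopingAlgebra.lift ℂ) (LieModule.toEnd ℂ L L)) :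
    -- the zero weight space of the adjoint module is `h`
    {x : L | ∀ s : H, ⁅(s : L), x⁆ = 0} = (H : Set L) ∧
    -- and `h` is irreducible under the Casimirs
    ∀ U : Submodule ℂ L, U ≤ H.toSubmodule →
      (∀ α ∈ R, ∀ v ∈ U, ρ (κ α) v ∈ U) →
      U = ⊥ ∨ U = H.toSubmodule := by
  subst hB hρ
  refine ⟨setOf_forall_lie_eq_zero_eq_cartan, fun U hUH hU => ?_⟩
  refine eq_bot_or_eq_cartan_of_smul_coroot_mem hUH fun α hα v hv => ?_
  have hαR : α.toLinear ∈ R := by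
    rw [hR]
    obtain ⟨x, hx, hx0⟩ := α.exists_ne_zero
    exact ⟨Weight.coe_toLinear_ne_zero_iff.mpr hα, x, hx0, isRootVector_of_mem_rootSpace hx⟩
  have h := hU _ hαR v hv
  rw [hκ _ hαR, map_smul, LinearMap.smul_apply, lift_toEnd_symmetrized_mul_apply
    (he _ hαR).1 (hf _ hαR).1 (hef _ hαR) ⟨v, hUH hv⟩, smul_smul, ht _ hαR,
    eq_coroot_of_isRootVector (he _ hαR).1 (hf _ hαR).1 (hef _ hαR) (hcoroot2 _ hαR)] at h
  have hne := root_apply_ne_zero_of_smul_killingForm_eq hα (ht _ hαR)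
  refine (U.smul_mem_iff hne).mp ?_
  rw [smul_smul]
  convert h using 2
  simp only [Weight.toLinear_apply]
  ring
end
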